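/- arXiv:2410.16697 — 2 statements merged into one kernel-verified Lean document; each statement's English description precedes it below -/
import Mathlib

section
/- Let W ∈ ∂θ(P) with P ≠ 0 and Q = P + W with SVD as in the context. Then D ∈ C_{θ*}(W,P) if and only if trace(D̃_{αα}) = 0, S(D̃_{α₁α₁}) is negative semidefinite, D̃_{α₃α₃} is symmetric positive semidefinite, and the blocks D̃_{α₃β}, D̃_{α₃c}, D̃_{βα₃}, D̃_{ββ}, and D̃_{βc} all vanish. -/
open Matrix Filter Set RealInnerProductSpace

noncomputable section

/-- Trace inner product on real matrices: `⟨A,B⟩ = trace (Aᵀ B)`. -/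
def minner {ι κ : Type*} [Fintype ι] [Fintype κ] (A B : Matrix ι κ ℝ) : ℝ :=
  (Aᵀ * B).trace

/-- Frobenius norm. -/
def fnorm {ι κ : Type*} [Fintype ι] [Fintype κ] (A : Matrix ι κ ℝ) : ℝ :=
  Real.sqrt (minner A A)

/-- Spectral norm (largest singular value), as the ℓ²-operator norm. -/
def specNorm {ι κ : Type*} [Fintype ι] [Fintype κ] (A : Matrix ι κ ℝ) : ℝ :=
  sSup {r : ℝ | ∃ x : κ → ℝ, ∑ j, x j ^ 2 = 1 ∧
    r = Real.sqrt (∑ i, (∑ j, A i j * x j) ^ 2)}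

/-- Convex subdifferential with respect to the trace inner product. -/
def subdiff {ι κ : Type*} [Fintype ι] [Fintype κ] (f : Matrix ι κ ℝ → ℝ)
    (X : Matrix ι κ ℝ) : Set (Matrix ι κ ℝ) :=
  {G | ∀ Y, f X + minner G (Y - X) ≤ f Y}

/-- One-sided directional derivative. -/
def dirDeriv {ι κ : Type*} [Fintype ι] [Fintype κ] (f : Matrix ι κ ℝ → ℝ)
    (X D : Matrix ι κ ℝ) : ℝ :=
  limUnder (nhdsWithin (0 : ℝ) (Set.Ioi 0)) fun t => (f (X + t • D) - f X) / t

/-- Critical cone of the spectral norm θ at `P` for `W`. -/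
def critTheta {ι κ : Type*} [Fintype ι] [Fintype κ] (P W : Matrix ι κ ℝ) :
    Set (Matrix ι κ ℝ) :=
  {D | dirDeriv specNorm P D = minner D W}

/-- Conjugate θ* of the spectral norm, as an extended-real-valued function
(it is the indicator of the nuclear norm unit ball). -/
def thetaStar {ι κ : Type*} [Fintype ι] [Fintype κ] (W : Matrix ι κ ℝ) : EReal :=
  ⨆ X : Matrix ι κ ℝ, ((minner W X - specNorm X : ℝ) : EReal)

/-- Lower directional epiderivative of an extended-real-valued function. -/
def epiDeriv {ι κ : Type*} [Fintype ι] [Fintype κ] (g : Matrix ι κ ℝ → EReal)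
    (X D : Matrix ι κ ℝ) : EReal :=
  liminf (fun p : ℝ × Matrix ι κ ℝ =>
      (((p.1)⁻¹ : ℝ) : EReal) * (g (X + p.1 • p.2) - g X))
    ((nhdsWithin (0 : ℝ) (Set.Ioi 0)) ×ˢ nhds D)

/-- Critical cone of θ* at `W` for `P`. -/
def critThetaStar {ι κ : Type*} [Fintype ι] [Fintype κ] (W P : Matrix ι κ ℝ) :
    Set (Matrix ι κ ℝ) :=
  {D | epiDeriv thetaStar W D = ((minner D P : ℝ) : EReal)}

/-- Second-order directional derivative. -/
def dirDeriv2 {ι κ : Type*} [Fintype ι] [Fintype κ] (f : Matrix ι κ ℝ → ℝ)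
    (X D W' : Matrix ι κ ℝ) : ℝ :=
  limUnder (nhdsWithin (0 : ℝ) (Set.Ioi 0)) fun t =>
    (f (X + t • D + (t ^ 2 / 2) • W') - f X - t * dirDeriv f X D) / (t ^ 2 / 2)

/-- The sigma term of θ: `ψ*_{(P,D)}(W) = (θ''(P;D,·))*(W)`. -/
def sigmaTheta {ι κ : Type*} [Fintype ι] [Fintype κ] (P D W : Matrix ι κ ℝ) : EReal :=
  ⨆ Z : Matrix ι κ ℝ, ((minner W Z - dirDeriv2 specNorm P D Z : ℝ) : EReal)

/-- Lower second-order directional epiderivative of an EReal-valued function. -/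
def epiDeriv2 {ι κ : Type*} [Fintype ι] [Fintype κ] (g : Matrix ι κ ℝ → EReal)
    (X D W' : Matrix ι κ ℝ) : EReal :=
  liminf (fun p : ℝ × Matrix ι κ ℝ =>
      ((2 / p.1 ^ 2 : ℝ) : EReal) *
        (g (X + p.1 • D + (p.1 ^ 2 / 2) • p.2) - g X - (p.1 : ℝ) * epiDeriv g X D))
    ((nhdsWithin (0 : ℝ) (Set.Ioi 0)) ×ˢ nhds W')

/-- The sigma term of θ*: `φ*_{(W,H)}(P) = ((θ*)''(W;H,·))*(P)`. -/
def sigmaThetaStar {ι κ : Type*} [Fintype ι] [Fintype κ] (W H P : Matrix ι κ ℝ) : EReal :=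
  ⨆ Z : Matrix ι κ ℝ, (((minner P Z : ℝ) : EReal) - epiDeriv2 thetaStar W H Z)

/-- Polar cone with respect to the trace inner product. -/
def polarCone {ι κ : Type*} [Fintype ι] [Fintype κ] (K : Set (Matrix ι κ ℝ)) :
    Set (Matrix ι κ ℝ) :=
  {H | ∀ D ∈ K, minner H D ≤ 0}

/-- Rectangular diagonal matrix `[Diag σ  0]`. -/
def diagRect {m n : ℕ} (σ : Fin m → ℝ) : Matrix (Fin m) (Fin n) ℝ :=
  Matrix.of fun i j => if (j : ℕ) = (i : ℕ) then σ i else 0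

/-- Symmetric part `S(A₁)` of the left m×m block of an m×n matrix. -/
def symLeft {m n : ℕ} (hmn : m ≤ n) (A : Matrix (Fin m) (Fin n) ℝ) :
    Matrix (Fin m) (Fin m) ℝ :=
  Matrix.of fun i j => (A i (Fin.castLE hmn j) + A j (Fin.castLE hmn i)) / 2

/-- Skew-symmetric part `T(A₁)` of the left m×m block of an m×n matrix. -/
def skewLeft {m n : ℕ} (hmn : m ≤ n) (A : Matrix (Fin m) (Fin n) ℝ) :
    Matrix (Fin m) (Fin m) ℝ :=
  Matrix.of fun i j => (A i (Fin.castLE hmn j) - A j (Fin.castLE hmn i)) / 2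

/-- Quadratic form `xᵀ A x`. -/
def quadForm {m : ℕ} (A : Matrix (Fin m) (Fin m) ℝ) (x : Fin m → ℝ) : ℝ :=
  ∑ i, ∑ j, x i * A i j * x j

/-- Proximal mapping. -/
def prox {ι κ : Type*} [Fintype ι] [Fintype κ] (f : Matrix ι κ ℝ → ℝ)
    (Z : Matrix ι κ ℝ) : Matrix ι κ ℝ :=
  Classical.epsilon fun Y =>
    ∀ X, f Y + (1 / 2) * fnorm (Y - Z) ^ 2 ≤ f X + (1 / 2) * fnorm (X - Z) ^ 2

/-- Directional derivative of the proximal mapping. -/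
def proxDeriv {ι κ : Type*} [Fintype ι] [Fintype κ] (f : Matrix ι κ ℝ → ℝ)
    (Z D : Matrix ι κ ℝ) : Matrix ι κ ℝ :=
  limUnder (nhdsWithin (0 : ℝ) (Set.Ioi 0)) fun t =>
    t⁻¹ • (prox f (Z + t • D) - prox f Z)

end

lemma minner_eq_sum {ι κ : Type*} [Fintype ι] [Fintype κ] (A B : Matrix ι κ ℝ) :
    minner A B = ∑ i, ∑ j, A i j * B i j := by
  simp only [minner, Matrix.trace, Matrix.diag_apply, Matrix.mul_apply, Matrix.transpose_apply]
  exact Finset.sum_comm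

lemma minner_comm {ι κ : Type*} [Fintype ι] [Fintype κ] (A B : Matrix ι κ ℝ) :
    minner A B = minner B A := by
  simp only [minner_eq_sum, mul_comm]

lemma minner_add_left {ι κ : Type*} [Fintype ι] [Fintype κ] (A B X : Matrix ι κ ℝ) :
    minner (A + B) X = minner A X + minner B X := by
  simp [minner, Matrix.add_mul]

lemma minner_smul_left {ι κ : Type*} [Fintype ι] [Fintype κ] (c : ℝ) (A X : Matrix ι κ ℝ) :
    minner (c • A) X = c * minner A X := by
  simp [minner]

lemma minner_add_right {ι κ : Type*} [Fintype ι] [Fintype κ] (X A B : Matrix ι κ ℝ) :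
    minner X (A + B) = minner X A + minner X B := by
  simp [minner, Matrix.mul_add]

lemma minner_sub_right {ι κ : Type*} [Fintype ι] [Fintype κ] (X A B : Matrix ι κ ℝ) :
    minner X (A - B) = minner X A - minner X B := by
  simp [minner, Matrix.mul_sub]

lemma minner_smul_right {ι κ : Type*} [Fintype ι] [Fintype κ] (c : ℝ) (X A : Matrix ι κ ℝ) :
    minner X (c • A) = c * minner X A := by
  simp [minner]

lemma minner_vecMulVec {ι κ : Type*} [Fintype ι] [Fintype κ] (u : ι → ℝ) (v : κ → ℝ)
    (X : Matrix ι κ ℝ) : minner (vecMulVec u v) X = u ⬝ᵥ X *ᵥ v := by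
  simp only [minner_eq_sum, vecMulVec_apply, dotProduct, mulVec, Finset.mul_sum]
  exact Finset.sum_congr rfl fun i _ => Finset.sum_congr rfl fun j _ => by ring

lemma minner_rotate {m n : ℕ} (U : Matrix (Fin m) (Fin m) ℝ) (V : Matrix (Fin n) (Fin n) ℝ)
    (A X : Matrix (Fin m) (Fin n) ℝ) :
    minner (U * A * Vᵀ) X = minner A (Uᵀ * X * V) := by
  simp only [minner, transpose_mul, transpose_transpose]
  rw [Matrix.mul_assoc, Matrix.trace_mul_comm]
  simp only [Matrix.mul_assoc]

lemma dotProduct_self_mulVec_le_sum_sq {ι κ : Type*} [Fintype ι] [Fintype κ]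
    (A : Matrix ι κ ℝ) (x : κ → ℝ) :
    (A *ᵥ x) ⬝ᵥ (A *ᵥ x) ≤ (∑ i, ∑ j, A i j ^ 2) * (x ⬝ᵥ x) := by
  rw [Finset.sum_mul]
  refine Finset.sum_le_sum fun i _ => ?_
  have h := Finset.sum_mul_sq_le_sq_mul_sq Finset.univ (A i) x
  simp only [dotProduct, mulVec, ← sq]
  exact h

lemma specNorm_bddAbove {ι κ : Type*} [Fintype ι] [Fintype κ] (A : Matrix ι κ ℝ) :
    BddAbove {r : ℝ | ∃ x : κ → ℝ, ∑ j, x j ^ 2 = 1 ∧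
      r = Real.sqrt (∑ i, (∑ j, A i j * x j) ^ 2)} := by
  refine ⟨Real.sqrt (∑ i, ∑ j, A i j ^ 2), ?_⟩
  rintro r ⟨x, hx, rfl⟩
  have h := dotProduct_self_mulVec_le_sum_sq A x
  simp only [dotProduct, mulVec, ← sq] at h
  rw [hx, mul_one] at h
  exact Real.sqrt_le_sqrt h

lemma specNorm_nonneg {ι κ : Type*} [Fintype ι] [Fintype κ] (A : Matrix ι κ ℝ) :
    0 ≤ specNorm A := by
  apply Real.sSup_nonneg
  rintro r ⟨x, -, rfl⟩
  exact Real.sqrt_nonneg _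

lemma dotProduct_self_nonneg' {ι : Type*} [Fintype ι] (x : ι → ℝ) : 0 ≤ x ⬝ᵥ x :=
  Finset.sum_nonneg fun i _ => mul_self_nonneg (x i)

lemma dotProduct_self_mulVec_le {ι κ : Type*} [Fintype ι] [Fintype κ]
    (A : Matrix ι κ ℝ) (x : κ → ℝ) :
    (A *ᵥ x) ⬝ᵥ (A *ᵥ x) ≤ specNorm A ^ 2 * (x ⬝ᵥ x) := by
  rcases (dotProduct_self_nonneg' x).eq_or_lt with h | h
  · have h0 : x = 0 := dotProduct_self_eq_zero.1 h.symm
    simp [h0]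
  · set r := Real.sqrt (x ⬝ᵥ x) with hr
    have hr0 : 0 < r := Real.sqrt_pos.2 h
    have hr2 : r ^ 2 = x ⬝ᵥ x := Real.sq_sqrt h.le
    set y := r⁻¹ • x with hy
    have hyy : ∑ j, y j ^ 2 = 1 := by
      have : ∑ j, y j ^ 2 = y ⬝ᵥ y := by simp [dotProduct, sq]
      rw [this, hy, smul_dotProduct, dotProduct_smul, ← hr2]
      simp only [smul_eq_mul]
      field_simp
    have hle := le_csSup (specNorm_bddAbove A) ⟨y, hyy, rfl⟩
    have h1 : (A *ᵥ y) ⬝ᵥ (A *ᵥ y) ≤ specNorm A ^ 2 := by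
      have h2 := (Real.sqrt_le_iff.1 hle).2
      simp only [dotProduct, mulVec, ← sq]
      exact h2
    rw [hy, mulVec_smul, smul_dotProduct, dotProduct_smul] at h1
    simp only [smul_eq_mul] at h1
    rw [← hr2]
    field_simp at h1
    linarith

lemma specNorm_le {ι κ : Type*} [Fintype ι] [Fintype κ] {A : Matrix ι κ ℝ} {c : ℝ} (hc : 0 ≤ c)
    (h : ∀ x : κ → ℝ, (A *ᵥ x) ⬝ᵥ (A *ᵥ x) ≤ c ^ 2 * (x ⬝ᵥ x)) : specNorm A ≤ c := by
  refine Real.sSup_le ?_ hc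
  rintro r ⟨x, hx, rfl⟩
  have h1 := h x
  simp only [dotProduct, mulVec, ← sq] at h1
  rw [hx, mul_one] at h1
  exact Real.sqrt_le_iff.2 ⟨hc, h1⟩

lemma specNorm_smul_le {ι κ : Type*} [Fintype ι] [Fintype κ] (A : Matrix ι κ ℝ) {t : ℝ}
    (ht : 0 ≤ t) : specNorm (t • A) ≤ t * specNorm A := by
  refine specNorm_le (mul_nonneg ht (specNorm_nonneg A)) fun x => ?_
  rw [smul_mulVec, smul_dotProduct, dotProduct_smul, smul_eq_mul, smul_eq_mul]
  nlinarith [mul_le_mul_of_nonneg_left (dotProduct_self_mulVec_le A x) (sq_nonneg t)]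

lemma specNorm_zero {ι κ : Type*} [Fintype ι] [Fintype κ] :
    specNorm (0 : Matrix ι κ ℝ) = 0 :=
  le_antisymm (specNorm_le le_rfl (by simp)) (specNorm_nonneg _)

lemma dotProduct_self_mulVec_orthogonal {ι : Type*} [Fintype ι] [DecidableEq ι]
    {V : Matrix ι ι ℝ} (hV : Vᵀ * V = 1) (x : ι → ℝ) :
    (V *ᵥ x) ⬝ᵥ (V *ᵥ x) = x ⬝ᵥ x := by
  rw [dotProduct_mulVec, vecMul_mulVec, hV, vecMul_one]

lemma specNorm_rotate_le {m n : ℕ} {U : Matrix (Fin m) (Fin m) ℝ}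
    {V : Matrix (Fin n) (Fin n) ℝ} (hU : Uᵀ * U = 1) (hV : Vᵀ * V = 1)
    (X : Matrix (Fin m) (Fin n) ℝ) : specNorm (U * X * V) ≤ specNorm X := by
  refine specNorm_le (specNorm_nonneg X) fun x => ?_
  rw [← mulVec_mulVec, ← mulVec_mulVec, dotProduct_self_mulVec_orthogonal hU,
    ← dotProduct_self_mulVec_orthogonal hV x]
  exact dotProduct_self_mulVec_le X _

lemma bilinear_le_specNorm {ι κ : Type*} [Fintype ι] [Fintype κ] (X : Matrix ι κ ℝ)
    (u : ι → ℝ) (v : κ → ℝ) :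
    u ⬝ᵥ X *ᵥ v ≤ (u ⬝ᵥ u + v ⬝ᵥ v) / 2 * specNorm X := by
  set y := X *ᵥ v with hy
  have hyv : y ⬝ᵥ y ≤ specNorm X ^ 2 * (v ⬝ᵥ v) := dotProduct_self_mulVec_le X v
  have hs := specNorm_nonneg X
  rcases hs.eq_or_lt with h0 | hpos
  · have : y ⬝ᵥ y = 0 := le_antisymm (by rw [← h0] at hyv; simpa using hyv)
      (dotProduct_self_nonneg' y)
    rw [dotProduct_self_eq_zero.1 this, ← h0]
    simp
  · have h1 := dotProduct_self_nonneg' (specNorm X • u - y)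
    simp only [sub_dotProduct, dotProduct_sub, smul_dotProduct, dotProduct_smul, smul_eq_mul,
      dotProduct_comm y u] at h1
    have h2 : specNorm X * (u ⬝ᵥ y) ≤ specNorm X * ((u ⬝ᵥ u + v ⬝ᵥ v) / 2 * specNorm X) := by
      nlinarith
    exact le_of_mul_le_mul_left h2 hpos

/-- The nuclear norm of `A` is at most `c`, expressed through duality with the spectral norm. -/
def NuclearLE {ι κ : Type*} [Fintype ι] [Fintype κ] (A : Matrix ι κ ℝ) (c : ℝ) : Prop :=
  ∀ X : Matrix ι κ ℝ, minner A X ≤ c * specNorm X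

namespace NuclearLE

variable {ι κ : Type*} [Fintype ι] [Fintype κ] {A B : Matrix ι κ ℝ} {a b : ℝ}

lemma add (hA : NuclearLE A a) (hB : NuclearLE B b) : NuclearLE (A + B) (a + b) := fun X => by
  rw [minner_add_left, add_mul]
  exact add_le_add (hA X) (hB X)

lemma smul {t : ℝ} (ht : 0 ≤ t) (hA : NuclearLE A a) : NuclearLE (t • A) (t * a) := fun X => by
  rw [minner_smul_left, mul_assoc]
  exact mul_le_mul_of_nonneg_left (hA X) ht

lemma mono (hA : NuclearLE A a) (hab : a ≤ b) : NuclearLE A b := fun X =>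
  (hA X).trans (mul_le_mul_of_nonneg_right hab (specNorm_nonneg X))

lemma zero : NuclearLE (0 : Matrix ι κ ℝ) 0 := fun X => by simp [minner]

lemma sum {τ : Type*} (s : Finset τ) (F : τ → Matrix ι κ ℝ) (f : τ → ℝ)
    (h : ∀ k ∈ s, NuclearLE (F k) (f k)) : NuclearLE (∑ k ∈ s, F k) (∑ k ∈ s, f k) := by
  classical
  induction s using Finset.induction_on with
  | empty => simpa using zero
  | insert k s hk ih =>
    rw [Finset.sum_insert hk, Finset.sum_insert hk]
    exact (h k (Finset.mem_insert_self k s)).add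
      (ih fun l hl => h l (Finset.mem_insert_of_mem hl))

lemma vecMulVec (u : ι → ℝ) (v : κ → ℝ) :
    NuclearLE (vecMulVec u v) ((u ⬝ᵥ u + v ⬝ᵥ v) / 2) := fun X => by
  rw [minner_vecMulVec]
  exact bilinear_le_specNorm X u v

lemma rotate {m n : ℕ} {U : Matrix (Fin m) (Fin m) ℝ} {V : Matrix (Fin n) (Fin n) ℝ}
    (hU : Uᵀ * U = 1) (hV : Vᵀ * V = 1) {A : Matrix (Fin m) (Fin n) ℝ} {a : ℝ} (ha : 0 ≤ a)
    (hA : NuclearLE A a) : NuclearLE (U * A * Vᵀ) a := fun X => by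
  rw [minner_rotate]
  refine (hA _).trans (mul_le_mul_of_nonneg_left ?_ ha)
  exact specNorm_rotate_le (by rw [transpose_transpose]; exact mul_eq_one_comm.1 hU) hV X

end NuclearLE

lemma thetaStar_eq_zero {ι κ : Type*} [Fintype ι] [Fintype κ] {A : Matrix ι κ ℝ}
    (hA : NuclearLE A 1) : thetaStar A = 0 := by
  apply le_antisymm
  · refine iSup_le fun X => ?_
    have := hA X
    exact_mod_cast (by linarith : minner A X - specNorm X ≤ 0)
  · refine le_trans ?_ (le_iSup _ (0 : Matrix ι κ ℝ))
    rw [specNorm_zero]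
    simp [minner]

lemma thetaStar_eq_top {ι κ : Type*} [Fintype ι] [Fintype κ] {A : Matrix ι κ ℝ}
    (hA : ¬ NuclearLE A 1) : thetaStar A = ⊤ := by
  simp only [NuclearLE, not_forall, not_le, one_mul] at hA
  obtain ⟨X, hX⟩ := hA
  rw [EReal.eq_top_iff_forall_lt]
  intro y
  set d := minner A X - specNorm X with hd
  have hd0 : 0 < d := sub_pos.2 hX
  set t := (|y| + 1) / d with ht
  have ht0 : 0 ≤ t := by positivity
  refine lt_of_lt_of_le ?_ (le_iSup _ (t • X))
  rw [EReal.coe_lt_coe_iff, minner_smul_right]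
  have h1 := specNorm_smul_le X ht0
  have h2 : t * d = |y| + 1 := by rw [ht]; field_simp
  have h3 := le_abs_self y
  rw [hd] at h2
  linarith

/-- The contingent cone of the nuclear norm unit ball. -/
def nuclearTangent {ι κ : Type*} [Fintype ι] [Fintype κ] (W : Matrix ι κ ℝ) :
    Set (Matrix ι κ ℝ) :=
  {D | ∃ᶠ p : ℝ × Matrix ι κ ℝ in (nhdsWithin (0 : ℝ) (Set.Ioi 0)) ×ˢ nhds D,
    NuclearLE (W + p.1 • p.2) 1}

lemma eventually_prod_pos {ι κ : Type*} [Fintype ι] [Fintype κ] (D : Matrix ι κ ℝ) :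
    ∀ᶠ p : ℝ × Matrix ι κ ℝ in (nhdsWithin (0 : ℝ) (Set.Ioi 0)) ×ˢ nhds D, 0 < p.1 :=
  (eventually_mem_nhdsWithin (a := (0 : ℝ)) (s := Set.Ioi 0)).prod_inl _

lemma mem_critThetaStar_iff {ι κ : Type*} [Fintype ι] [Fintype κ] {W P D : Matrix ι κ ℝ}
    (hW : NuclearLE W 1) :
    D ∈ critThetaStar W P ↔ D ∈ nuclearTangent W ∧ minner D P = 0 := by
  have hin : ∀ p : ℝ × Matrix ι κ ℝ, NuclearLE (W + p.1 • p.2) 1 →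
      (((p.1)⁻¹ : ℝ) : EReal) * (thetaStar (W + p.1 • p.2) - thetaStar W) = 0 := by
    intro p hp
    simp [thetaStar_eq_zero hW, thetaStar_eq_zero hp]
  have hout : ∀ p : ℝ × Matrix ι κ ℝ, 0 < p.1 → ¬ NuclearLE (W + p.1 • p.2) 1 →
      (((p.1)⁻¹ : ℝ) : EReal) * (thetaStar (W + p.1 • p.2) - thetaStar W) = ⊤ := by
    intro p hp hn
    rw [thetaStar_eq_zero hW, thetaStar_eq_top hn, sub_zero]
    exact EReal.coe_mul_top_of_pos (inv_pos.2 hp)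
  by_cases hT : D ∈ nuclearTangent W
  · have h0 : epiDeriv thetaStar W D = 0 := by
      apply le_antisymm
      · exact liminf_le_of_frequently_le' (hT.mono fun p hp => (hin p hp).le)
      · refine le_liminf_of_le (by isBoundedDefault) ?_
        filter_upwards [eventually_prod_pos D] with p hp
        by_cases hB : NuclearLE (W + p.1 • p.2) 1
        · exact (hin p hB).ge
        · rw [hout p hp hB]
          exact le_top
    simp only [critThetaStar, mem_ofPred_eq, h0, hT, true_and]
    rw [eq_comm]
    exact_mod_cast Iff.rfl
  · have h0 : epiDeriv thetaStar W D = ⊤ := by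
      rw [eq_top_iff]
      refine le_liminf_of_le (by isBoundedDefault) ?_
      filter_upwards [eventually_prod_pos D, not_frequently.1 hT] with p hp hB
      exact (hout p hp hB).ge
    simp [critThetaStar, h0, hT, (EReal.coe_ne_top _).symm]

lemma minner_nonpos_of_mem_nuclearTangent {ι κ : Type*} [Fintype ι] [Fintype κ]
    {W D Z : Matrix ι κ ℝ} (hD : D ∈ nuclearTangent W) (hZ : specNorm Z ≤ 1)
    (hWZ : minner W Z = 1) : minner D Z ≤ 0 := by
  by_contra! hpos
  have hcont : Continuous fun E : Matrix ι κ ℝ => minner E Z := by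
    unfold minner
    fun_prop
  have hev : ∀ᶠ p : ℝ × Matrix ι κ ℝ in (nhdsWithin (0 : ℝ) (Set.Ioi 0)) ×ˢ nhds D,
      0 < minner p.2 Z :=
    (hcont.continuousAt.eventually (lt_mem_nhds hpos)).prod_inr _
  obtain ⟨p, hp, hp1, hp2⟩ := (hD.and_eventually ((eventually_prod_pos D).and hev)).exists
  have h := hp Z
  rw [minner_add_left, minner_smul_left, hWZ] at h
  nlinarith [mul_pos hp1 hp2]

lemma mem_nuclearTangent_of_quadratic {ι κ : Type*} [Fintype ι] [Fintype κ]
    {W D : Matrix ι κ ℝ} {C : ℝ} (hC : 0 ≤ C)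
    (h : ∀ t : ℝ, 0 < t → NuclearLE (W + t • D) (1 + C * t ^ 2)) : D ∈ nuclearTangent W := by
  set E : ℝ → Matrix ι κ ℝ := fun t => (1 + C * t ^ 2)⁻¹ • (D - (C * t) • W) with hE
  have hEcont : Tendsto E (nhdsWithin (0 : ℝ) (Set.Ioi 0)) (nhds D) := by
    have hc : ContinuousAt E 0 := by
      have : ContinuousAt (fun t : ℝ => (1 + C * t ^ 2)⁻¹) 0 :=
        ContinuousAt.inv₀ (by fun_prop) (by simp)
      exact this.smul (by fun_prop)
    have h0 : E 0 = D := by simp [hE]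
    have := hc.tendsto
    rw [h0] at this
    exact this.mono_left nhdsWithin_le_nhds
  have hT : Tendsto (fun t : ℝ => (t, E t)) (nhdsWithin (0 : ℝ) (Set.Ioi 0))
      ((nhdsWithin (0 : ℝ) (Set.Ioi 0)) ×ˢ nhds D) := tendsto_id.prodMk hEcont
  refine hT.frequently (Eventually.frequently ?_)
  filter_upwards [self_mem_nhdsWithin] with t ht
  have ht0 : 0 < t := ht
  have hpos : 0 < 1 + C * t ^ 2 := by positivity
  have heq : W + t • E t = (1 + C * t ^ 2)⁻¹ • (W + t • D) := by
    ext i j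
    simp only [hE, Matrix.add_apply, Matrix.smul_apply, Matrix.sub_apply, smul_eq_mul]
    field_simp
    ring
  have := (h t ht0).smul (inv_pos.2 hpos).le
  rw [inv_mul_cancel₀ hpos.ne'] at this
  show NuclearLE (W + t • E t) 1
  rw [heq]
  exact this

lemma contraction_test {ι κ : Type*} [Fintype ι] [Fintype κ] {W D E : Matrix ι κ ℝ}
    (hE : ∀ x, (E *ᵥ x) ⬝ᵥ (E *ᵥ x) ≤ x ⬝ᵥ x) (hWE : minner W E = 1) (hDE : minner D E = 0)
    (hD : ∀ Z, specNorm Z ≤ 1 → minner W Z = 1 → minner D Z ≤ 0)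
    {u : ι → ℝ} {v : κ → ℝ} {s : ℝ} (hu : u ⬝ᵥ u = 1) (hv : v ⬝ᵥ v = 1)
    (hWu : u ᵥ* W = 0) (hWv : W *ᵥ v = 0) (hs : s ^ 2 ≤ 1) :
    (u ⬝ᵥ E *ᵥ v + s) * (u ⬝ᵥ D *ᵥ v) ≤ u ⬝ᵥ D *ᵥ (u ᵥ* E) + (E *ᵥ v) ⬝ᵥ D *ᵥ v := by
  set K := E - vecMulVec u (u ᵥ* E) - vecMulVec (E *ᵥ v) v
    + (u ⬝ᵥ E *ᵥ v + s) • vecMulVec u v with hK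
  have hKX : ∀ X, minner X K = minner X E - u ⬝ᵥ X *ᵥ (u ᵥ* E) - (E *ᵥ v) ⬝ᵥ X *ᵥ v
      + (u ⬝ᵥ E *ᵥ v + s) * (u ⬝ᵥ X *ᵥ v) := by
    intro X
    rw [hK, minner_add_right, minner_sub_right, minner_sub_right, minner_smul_right]
    simp only [minner_comm X (vecMulVec _ _), minner_vecMulVec]
  have hKW : minner W K = 1 := by
    rw [hKX, hWE, hWv, dotProduct_mulVec u W, hWu]
    simp
  have hKn : specNorm K ≤ 1 := by
    refine specNorm_le zero_le_one fun y => ?_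
    set b := v ⬝ᵥ y with hb
    set z := y - b • v with hz
    set q := E *ᵥ z with hq
    have hKy : K *ᵥ y = q - (u ⬝ᵥ q) • u + (s * b) • u := by
      have h1 : (u ᵥ* E) ⬝ᵥ y = u ⬝ᵥ E *ᵥ y := (dotProduct_mulVec u E y).symm
      have h2 : q = E *ᵥ y - b • E *ᵥ v := by rw [hq, hz, mulVec_sub, mulVec_smul]
      rw [hK, add_mulVec, sub_mulVec, sub_mulVec, smul_mulVec, h2]
      simp only [vecMulVec_mulVec, h1, ← hb, dotProduct_sub, dotProduct_smul]
      ext i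
      simp
      ring
    have hzz : z ⬝ᵥ z = y ⬝ᵥ y - b ^ 2 := by
      rw [hz]
      simp only [sub_dotProduct, dotProduct_sub, smul_dotProduct, dotProduct_smul, smul_eq_mul,
        dotProduct_comm y v, hv, ← hb]
      ring
    have hqq : q ⬝ᵥ q ≤ z ⬝ᵥ z := hE z
    have hKK : (K *ᵥ y) ⬝ᵥ (K *ᵥ y) = q ⬝ᵥ q - (u ⬝ᵥ q) ^ 2 + s ^ 2 * b ^ 2 := by
      rw [hKy]
      simp only [sub_dotProduct, dotProduct_sub, add_dotProduct, dotProduct_add, smul_dotProduct,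
        dotProduct_smul, smul_eq_mul, dotProduct_comm q u, hu]
      ring
    rw [hKK]
    nlinarith [sq_nonneg (u ⬝ᵥ q), mul_le_mul_of_nonneg_right hs (sq_nonneg b)]
  have := hD K hKn hKW
  rw [hKX, hDE] at this
  linarith

lemma eq_zero_of_mul_le_sq_mul {K M : ℝ} (h : ∀ t : ℝ, |t| ≤ 1 → t * K ≤ t ^ 2 * M) : K = 0 := by
  have h1 := h 1 (by simp)
  have h2 := h (-1) (by simp)
  have hM : 0 ≤ M := by nlinarith
  by_contra hK
  set c := |K| + M + 1 with hc
  have hKpos : 0 < |K| := abs_pos.2 hK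
  have hcpos : 0 < c := by positivity
  have hle : |K / c| ≤ 1 := by
    rw [abs_div, abs_of_pos hcpos, div_le_one hcpos]
    linarith
  have h3 := h (K / c) hle
  rw [div_mul_eq_mul_div, div_pow, div_mul_eq_mul_div, div_le_div_iff₀ hcpos (by positivity)] at h3
  have hKK : 0 < K ^ 2 * c := by positivity
  nlinarith

lemma eq_of_rotation_le {A B C E : ℝ}
    (h : ∀ c s : ℝ, c ^ 2 + s ^ 2 = 1 → c * A + s * B ≤ A + s * c * C + s ^ 2 * E) : B = C := by
  refine sub_eq_zero.1 (eq_zero_of_mul_le_sq_mul (M := |B + C| + 2 * |A| + 2 * |E|) fun t ht => ?_)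
  have hpos : 0 < 1 + t ^ 2 := by positivity
  have h1 := h ((1 - t ^ 2) / (1 + t ^ 2)) (2 * t / (1 + t ^ 2)) (by field_simp; ring)
  have h2 : (1 - t ^ 2) * (1 + t ^ 2) * A + 2 * t * (1 + t ^ 2) * B
      ≤ (1 + t ^ 2) ^ 2 * A + 2 * t * (1 - t ^ 2) * C + 4 * t ^ 2 * E := by
    have := mul_le_mul_of_nonneg_right h1 (sq_nonneg (1 + t ^ 2))
    have e : ∀ x y : ℝ, (x / (1 + t ^ 2) * A + y / (1 + t ^ 2) * B) * (1 + t ^ 2) ^ 2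
        = x * (1 + t ^ 2) * A + y * (1 + t ^ 2) * B := fun x y => by field_simp
    have e' : ∀ x y : ℝ, (A + y / (1 + t ^ 2) * (x / (1 + t ^ 2)) * C + (y / (1 + t ^ 2)) ^ 2 * E)
        * (1 + t ^ 2) ^ 2 = (1 + t ^ 2) ^ 2 * A + y * x * C + y ^ 2 * E :=
      fun x y => by field_simp
    rw [e, e'] at this
    linarith
  have ht2 : t ^ 2 ≤ 1 := by rwa [sq_le_one_iff_abs_le_one]
  have e1 : -t * (B + C) ≤ |B + C| := by
    calc -t * (B + C) ≤ |-t * (B + C)| := le_abs_self _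
      _ = |t| * |B + C| := by rw [abs_mul, abs_neg]
      _ ≤ |B + C| := mul_le_of_le_one_left (abs_nonneg _) ht
  have e2 : (1 + t ^ 2) * A ≤ 2 * |A| := by
    nlinarith [le_abs_self A, abs_nonneg A]
  nlinarith [mul_le_mul_of_nonneg_left e1 (sq_nonneg t), mul_le_mul_of_nonneg_left e2 (sq_nonneg t),
    mul_le_mul_of_nonneg_left (le_abs_self E) (sq_nonneg t)]

section Coordinates

variable {m n : ℕ} (hmn : m ≤ n)

lemma diagRect_apply_castLE (p : Fin m → ℝ) (i k : Fin m) :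
    (diagRect p : Matrix (Fin m) (Fin n) ℝ) i (Fin.castLE hmn k) = if i = k then p i else 0 := by
  simp only [diagRect, Matrix.of_apply, Fin.val_castLE, Fin.ext_iff, eq_comm]

lemma diagRect_apply_of_le (p : Fin m → ℝ) (i : Fin m) {j : Fin n} (hj : m ≤ (j : ℕ)) :
    (diagRect p : Matrix (Fin m) (Fin n) ℝ) i j = 0 := by
  simp only [diagRect, Matrix.of_apply]
  rw [if_neg]
  omega

lemma eq_castLE_or_le (j : Fin n) : (∃ k : Fin m, j = Fin.castLE hmn k) ∨ m ≤ (j : ℕ) := by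
  by_cases hj : (j : ℕ) < m
  · exact Or.inl ⟨⟨j, hj⟩, rfl⟩
  · exact Or.inr (not_lt.1 hj)

lemma sum_eq_sum_castLE {f : Fin n → ℝ} (hf : ∀ j : Fin n, m ≤ (j : ℕ) → f j = 0) :
    ∑ j, f j = ∑ i, f (Fin.castLE hmn i) := by
  refine (Fintype.sum_of_injective (Fin.castLE hmn) (Fin.castLE_injective hmn) _ _ ?_
    fun _ => rfl).symm
  intro j hj
  rcases eq_castLE_or_le hmn j with ⟨k, rfl⟩ | h
  · exact absurd ⟨k, rfl⟩ hj
  · exact hf j h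

lemma diagRect_mulVec (p : Fin m → ℝ) (x : Fin n → ℝ) :
    (diagRect p : Matrix (Fin m) (Fin n) ℝ) *ᵥ x = fun i => p i * x (Fin.castLE hmn i) := by
  ext i
  rw [mulVec, dotProduct, sum_eq_sum_castLE hmn]
  · simp [diagRect_apply_castLE hmn]
  · intro j hj
    rw [diagRect_apply_of_le p i hj, zero_mul]

lemma vecMul_diagRect_castLE (p u : Fin m → ℝ) (k : Fin m) :
    (u ᵥ* (diagRect p : Matrix (Fin m) (Fin n) ℝ)) (Fin.castLE hmn k) = u k * p k := by
  simp [vecMul, dotProduct, diagRect_apply_castLE hmn]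

lemma vecMul_diagRect_of_le (p u : Fin m → ℝ) {j : Fin n} (hj : m ≤ (j : ℕ)) :
    (u ᵥ* (diagRect p : Matrix (Fin m) (Fin n) ℝ)) j = 0 := by
  simp [vecMul, dotProduct, diagRect_apply_of_le p _ hj]

lemma minner_diagRect (p : Fin m → ℝ) (X : Matrix (Fin m) (Fin n) ℝ) :
    minner X (diagRect p) = ∑ i, p i * X i (Fin.castLE hmn i) := by
  rw [minner_eq_sum]
  refine Finset.sum_congr rfl fun i _ => ?_
  rw [sum_eq_sum_castLE hmn]
  · simp [diagRect_apply_castLE hmn, mul_comm]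
  · intro j hj
    rw [diagRect_apply_of_le p i hj, mul_zero]

lemma diagRect_contraction (hmn : m ≤ n) {p : Fin m → ℝ} (hp : ∀ i, p i ^ 2 ≤ 1) (x : Fin n → ℝ) :
    ((diagRect p : Matrix (Fin m) (Fin n) ℝ) *ᵥ x) ⬝ᵥ
      ((diagRect p : Matrix (Fin m) (Fin n) ℝ) *ᵥ x) ≤ x ⬝ᵥ x := by
  rw [diagRect_mulVec hmn]
  calc _ ≤ ∑ i, x (Fin.castLE hmn i) ^ 2 := by
        refine Finset.sum_le_sum fun i _ => ?_
        nlinarith [mul_le_mul_of_nonneg_right (hp i) (sq_nonneg (x (Fin.castLE hmn i)))]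
    _ = ∑ j ∈ Finset.univ.map (Fin.castLEEmb hmn), x j ^ 2 := by simp
    _ ≤ ∑ j, x j ^ 2 :=
        Finset.sum_le_univ_sum_of_nonneg fun j => sq_nonneg (x j)
    _ = x ⬝ᵥ x := by simp [dotProduct, sq]

lemma diagRect_mulVec_single_castLE (p : Fin m → ℝ) (k : Fin m) :
    (diagRect p : Matrix (Fin m) (Fin n) ℝ) *ᵥ Pi.single (Fin.castLE hmn k) 1
      = p k • Pi.single k 1 := by
  rw [diagRect_mulVec hmn]
  ext i
  by_cases h : i = k
  · subst h; simp
  · have : Fin.castLE hmn i ≠ Fin.castLE hmn k := fun e => h (Fin.castLE_injective hmn e)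
    simp [h, this]

lemma diagRect_mulVec_single_of_le (hmn : m ≤ n) (p : Fin m → ℝ) {j : Fin n} (hj : m ≤ (j : ℕ)) :
    (diagRect p : Matrix (Fin m) (Fin n) ℝ) *ᵥ Pi.single j 1 = 0 := by
  rw [diagRect_mulVec hmn]
  ext i
  have : Fin.castLE hmn i ≠ j := by
    intro e
    have := congrArg Fin.val e
    simp at this
    omega
  simp [this]

lemma single_vecMul_diagRect (p : Fin m → ℝ) (i : Fin m) :
    Pi.single i 1 ᵥ* (diagRect p : Matrix (Fin m) (Fin n) ℝ)
      = p i • Pi.single (Fin.castLE hmn i) 1 := by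
  ext j
  rcases eq_castLE_or_le hmn j with ⟨k, rfl⟩ | hj
  · rw [vecMul_diagRect_castLE hmn]
    by_cases h : k = i
    · subst h; simp
    · have : Fin.castLE hmn k ≠ Fin.castLE hmn i := fun e => h (Fin.castLE_injective hmn e)
      simp [h, this]
  · rw [vecMul_diagRect_of_le p _ hj]
    have : j ≠ Fin.castLE hmn i := by
      rintro rfl
      simp at hj
      omega
    simp [this]

end Coordinates

section Necessity

variable {m n : ℕ} {hmn : m ≤ n} {D : Matrix (Fin m) (Fin n) ℝ} {p : Fin m → ℝ}
  {F : Fin m → Prop}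

/-- The optimality inequality obtained by testing `D` against the contractions
`(1 - u uᵀ) [Diag p 0] (1 - v vᵀ) + s u vᵀ` with `u`, `v` supported on the indices in `F`
(and, for `v`, on the trailing columns). -/
def ContractionTest {m n : ℕ} (hmn : m ≤ n) (D : Matrix (Fin m) (Fin n) ℝ) (p : Fin m → ℝ)
    (F : Fin m → Prop) : Prop :=
  ∀ (u : Fin m → ℝ) (v : Fin n → ℝ) (s : ℝ), u ⬝ᵥ u = 1 → v ⬝ᵥ v = 1 →
    (∀ i, ¬ F i → u i = 0) → (∀ i, ¬ F i → v (Fin.castLE hmn i) = 0) → s ^ 2 ≤ 1 →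
    (u ⬝ᵥ (diagRect p : Matrix (Fin m) (Fin n) ℝ) *ᵥ v + s) * (u ⬝ᵥ D *ᵥ v) ≤
      u ⬝ᵥ D *ᵥ (u ᵥ* (diagRect p : Matrix (Fin m) (Fin n) ℝ)) +
        ((diagRect p : Matrix (Fin m) (Fin n) ℝ) *ᵥ v) ⬝ᵥ D *ᵥ v

namespace ContractionTest

lemma single_eq_zero_of_not {i : Fin m} (hi : F i) :
    ∀ k, ¬ F k → (Pi.single i (1 : ℝ) : Fin m → ℝ) k = 0 :=
  fun k hk => Pi.single_eq_of_ne (fun e : k = i => hk (e ▸ hi)) 1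

lemma single_castLE_eq_zero_of_not {i : Fin m} (hi : F i) :
    ∀ k, ¬ F k → (Pi.single (Fin.castLE hmn i) (1 : ℝ) : Fin n → ℝ) (Fin.castLE hmn k) = 0 :=
  fun k hk => Pi.single_eq_of_ne
    (fun e : Fin.castLE hmn k = Fin.castLE hmn i => hk (Fin.castLE_injective hmn e ▸ hi)) 1

lemma single_castLE_eq_zero_of_le {j : Fin n} (hj : m ≤ (j : ℕ)) (k : Fin m) :
    (Pi.single j (1 : ℝ) : Fin n → ℝ) (Fin.castLE hmn k) = 0 := by
  refine Pi.single_eq_of_ne (fun e => ?_) 1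
  have := congrArg Fin.val e
  simp at this
  omega

lemma diag_eq_zero (h : ContractionTest hmn D p F) {i : Fin m} (hi : F i) (hp0 : 0 ≤ p i)
    (hp1 : p i < 1) : D i (Fin.castLE hmn i) = 0 := by
  have key : ∀ s : ℝ, s ^ 2 ≤ 1 → (p i + s) * D i (Fin.castLE hmn i)
      ≤ p i * D i (Fin.castLE hmn i) + p i * D i (Fin.castLE hmn i) := by
    intro s hs
    have := h (Pi.single i 1) (Pi.single (Fin.castLE hmn i) 1) s (by simp) (by simp)
      (single_eq_zero_of_not hi) (single_castLE_eq_zero_of_not hi) hs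
    rw [diagRect_mulVec_single_castLE, single_vecMul_diagRect hmn] at this
    simpa [mulVec_smul] using this
  have h1 := key 1 (by norm_num)
  have h2 := key (-1) (by norm_num)
  nlinarith

lemma offDiag_eq_zero (h : ContractionTest hmn D p F) {i k : Fin m} (hi : F i) (hk : F k)
    (hp0 : 0 ≤ p i) (hp1 : p i < 1) (hq0 : 0 ≤ p k) (hq1 : p k < 1) :
    D i (Fin.castLE hmn k) = 0 := by
  by_cases hik : i = k
  · subst hik
    exact h.diag_eq_zero hi hp0 hp1
  have key : ∀ s : ℝ, s ^ 2 ≤ 1 → s * D i (Fin.castLE hmn k) ≤ 0 := by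
    intro s hs
    have := h (Pi.single i 1) (Pi.single (Fin.castLE hmn k) 1) s (by simp) (by simp)
      (single_eq_zero_of_not hi) (single_castLE_eq_zero_of_not hk) hs
    rw [diagRect_mulVec_single_castLE, single_vecMul_diagRect hmn] at this
    simpa [mulVec_smul, hik, h.diag_eq_zero hi hp0 hp1, h.diag_eq_zero hk hq0 hq1] using this
  have h1 := key 1 (by norm_num)
  have h2 := key (-1) (by norm_num)
  linarith

lemma trailing_eq_zero (h : ContractionTest hmn D p F) {i : Fin m} (hi : F i)
    (hp0 : 0 ≤ p i) (hp1 : p i < 1) {j : Fin n} (hj : m ≤ (j : ℕ)) : D i j = 0 := by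
  have key : ∀ s : ℝ, s ^ 2 ≤ 1 → s * D i j ≤ 0 := by
    intro s hs
    have := h (Pi.single i 1) (Pi.single j 1) s (by simp) (by simp)
      (single_eq_zero_of_not hi) (fun k _ => single_castLE_eq_zero_of_le hj k) hs
    rw [diagRect_mulVec_single_of_le hmn p hj, single_vecMul_diagRect hmn] at this
    simpa [mulVec_smul, h.diag_eq_zero hi hp0 hp1] using this
  have h1 := key 1 (by norm_num)
  have h2 := key (-1) (by norm_num)
  linarith

lemma row_eq (h : ContractionTest hmn D p F) {i k : Fin m} (hi : F i) (hk : F k)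
    (hp : p i = 1) (hik : i ≠ k) :
    D i (Fin.castLE hmn k) = p k * D k (Fin.castLE hmn i) := by
  have hne : Fin.castLE hmn i ≠ Fin.castLE hmn k := fun e => hik (Fin.castLE_injective hmn e)
  refine eq_of_rotation_le (A := D i (Fin.castLE hmn i)) (E := p k * D k (Fin.castLE hmn k))
    fun c s hcs => ?_
  have := h (Pi.single i 1)
    (c • Pi.single (Fin.castLE hmn i) 1 + s • Pi.single (Fin.castLE hmn k) 1) 1 (by simp)
    (by simp [hne, hne.symm]; linarith) (single_eq_zero_of_not hi)
    (fun l hl => by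
      simp only [Pi.add_apply, Pi.smul_apply]
      rw [single_castLE_eq_zero_of_not hi l hl, single_castLE_eq_zero_of_not hk l hl]
      simp) (by norm_num)
  rw [mulVec_add, mulVec_smul, mulVec_smul, diagRect_mulVec_single_castLE,
    diagRect_mulVec_single_castLE, single_vecMul_diagRect hmn] at this
  simp [mulVec_smul, mulVec_add, hik, hp] at this
  linarith

lemma col_eq (h : ContractionTest hmn D p F) {i k : Fin m} (hi : F i) (hk : F k)
    (hp : p i = 1) (hik : i ≠ k) :
    D k (Fin.castLE hmn i) = p k * D i (Fin.castLE hmn k) := by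
  refine eq_of_rotation_le (A := D i (Fin.castLE hmn i)) (E := p k * D k (Fin.castLE hmn k))
    fun c s hcs => ?_
  have := h (c • Pi.single i 1 + s • Pi.single k 1) (Pi.single (Fin.castLE hmn i) 1) 1
    (by simp [hik, hik.symm]; linarith) (by simp)
    (fun l hl => by
      simp only [Pi.add_apply, Pi.smul_apply]
      rw [single_eq_zero_of_not hi l hl, single_eq_zero_of_not hk l hl]
      simp) (single_castLE_eq_zero_of_not hi) (by norm_num)
  rw [diagRect_mulVec_single_castLE, add_vecMul, smul_vecMul, smul_vecMul,
    single_vecMul_diagRect hmn, single_vecMul_diagRect hmn] at this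
  simp [mulVec_smul, mulVec_add, hik, hp] at this
  linarith

lemma row_trailing_eq_zero (h : ContractionTest hmn D p F) {i : Fin m} (hi : F i)
    (hp : p i = 1) {j : Fin n} (hj : m ≤ (j : ℕ)) : D i j = 0 := by
  have hne : Fin.castLE hmn i ≠ j := by
    rintro rfl
    simp at hj
    omega
  refine eq_of_rotation_le (A := D i (Fin.castLE hmn i)) (E := 0) fun c s hcs => ?_
  have := h (Pi.single i 1) (c • Pi.single (Fin.castLE hmn i) 1 + s • Pi.single j 1) 1 (by simp)
    (by simp [hne, hne.symm]; linarith) (single_eq_zero_of_not hi)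
    (fun l hl => by
      simp only [Pi.add_apply, Pi.smul_apply]
      rw [single_castLE_eq_zero_of_not hi l hl, single_castLE_eq_zero_of_le hj l]
      simp) (by norm_num)
  rw [mulVec_add, mulVec_smul, mulVec_smul, diagRect_mulVec_single_castLE,
    diagRect_mulVec_single_of_le hmn p hj, single_vecMul_diagRect hmn] at this
  simp [mulVec_smul, mulVec_add, hp] at this
  linarith

lemma quadratic_nonneg (h : ContractionTest hmn D p F) {x : Fin m → ℝ}
    (hx : ∀ i, ¬ F i → x i = 0) (hp : ∀ i, x i ≠ 0 → p i = 1) :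
    0 ≤ ∑ i, ∑ j, x i * D i (Fin.castLE hmn j) * x j := by
  set J : Matrix (Fin m) (Fin n) ℝ := diagRect fun _ => 1 with hJ
  have hext : ∀ y : Fin m → ℝ, (y ᵥ* J) ⬝ᵥ (y ᵥ* J) = y ⬝ᵥ y := by
    intro y
    rw [dotProduct, sum_eq_sum_castLE hmn]
    · simp [hJ, vecMul_diagRect_castLE hmn, dotProduct]
    · intro j hj
      rw [hJ, vecMul_diagRect_of_le _ _ hj, zero_mul]
  have hform : ∑ i, ∑ j, x i * D i (Fin.castLE hmn j) * x j = x ⬝ᵥ D *ᵥ (x ᵥ* J) := by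
    simp only [dotProduct, mulVec]
    refine Finset.sum_congr rfl fun i _ => ?_
    rw [sum_eq_sum_castLE hmn, Finset.mul_sum]
    · refine Finset.sum_congr rfl fun j _ => ?_
      rw [hJ, vecMul_diagRect_castLE hmn]
      ring
    · intro j hj
      rw [hJ, vecMul_diagRect_of_le _ _ hj, mul_zero]
  rw [hform]
  rcases (dotProduct_self_nonneg' x).eq_or_lt with h0 | hpos
  · rw [dotProduct_self_eq_zero.1 h0.symm]
    simp
  set r := Real.sqrt (x ⬝ᵥ x) with hr
  have hr0 : 0 < r := Real.sqrt_pos.2 hpos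
  have hr2 : r ^ 2 = x ⬝ᵥ x := Real.sq_sqrt hpos.le
  set u := r⁻¹ • x with hu
  have hxu : x = r • u := by rw [hu, smul_smul, mul_inv_cancel₀ hr0.ne', one_smul]
  have huu : u ⬝ᵥ u = 1 := by
    rw [hu, smul_dotProduct, dotProduct_smul, ← hr2]
    simp only [smul_eq_mul]
    field_simp
  have hpu : ∀ i, p i * u i = u i := by
    intro i
    by_cases hxi : x i = 0
    · simp [hu, hxi]
    · rw [hp i hxi, one_mul]
  have hEv : (diagRect p : Matrix (Fin m) (Fin n) ℝ) *ᵥ (u ᵥ* J) = u := by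
    rw [diagRect_mulVec hmn]
    ext i
    rw [hJ, vecMul_diagRect_castLE hmn, mul_one, hpu]
  have huE : u ᵥ* (diagRect p : Matrix (Fin m) (Fin n) ℝ) = u ᵥ* J := by
    ext j
    rcases eq_castLE_or_le hmn j with ⟨k, rfl⟩ | hj
    · rw [hJ, vecMul_diagRect_castLE hmn, vecMul_diagRect_castLE hmn, mul_one, mul_comm, hpu]
    · rw [hJ, vecMul_diagRect_of_le _ _ hj, vecMul_diagRect_of_le _ _ hj]
  have hsupp : ∀ i, ¬ F i → u i = 0 := fun i hi => by simp [hu, hx i hi]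
  have := h u (u ᵥ* J) (-1) huu (by rw [hext, huu]) hsupp
    (fun i hi => by rw [hJ, vecMul_diagRect_castLE hmn, hsupp i hi, zero_mul]) (by norm_num)
  rw [hEv, huE, huu] at this
  rw [hxu, smul_vecMul, mulVec_smul, smul_dotProduct, dotProduct_smul, smul_eq_mul, smul_eq_mul]
  have h0 : 0 ≤ u ⬝ᵥ D *ᵥ (u ᵥ* J) := by linarith
  positivity

end ContractionTest

end Necessity

section Sufficiency

variable {m n : ℕ}

lemma diagRect_eq_sum (hmn : m ≤ n) (w : Fin m → ℝ) : (diagRect w : Matrix (Fin m) (Fin n) ℝ) =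
    ∑ k, w k • vecMulVec (Pi.single k 1) (Pi.single (Fin.castLE hmn k) 1) := by
  ext i j
  rw [Matrix.sum_apply]
  simp only [Matrix.smul_apply, vecMulVec_apply, smul_eq_mul]
  rw [Finset.sum_eq_single i]
  · simp [diagRect, Pi.single_apply, Fin.ext_iff]
  · intro k _ hk
    simp [Pi.single_apply, hk.symm]
  · simp

lemma nuclearLE_diagRect (hmn : m ≤ n) {w : Fin m → ℝ} (hw : ∀ k, 0 ≤ w k) :
    NuclearLE (diagRect w : Matrix (Fin m) (Fin n) ℝ) (∑ k, w k) := by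
  rw [diagRect_eq_sum hmn]
  refine NuclearLE.sum _ _ _ fun k _ => ?_
  have := (NuclearLE.vecMulVec (Pi.single k (1 : ℝ) : Fin m → ℝ)
    (Pi.single (Fin.castLE hmn k) (1 : ℝ) : Fin n → ℝ)).smul (hw k)
  simpa using this

lemma nuclearLE_posSemidef_mul (hmn : m ≤ n) {S : Matrix (Fin m) (Fin m) ℝ} (hS : S.PosSemidef) :
    NuclearLE (S * (diagRect (fun _ => 1) : Matrix (Fin m) (Fin n) ℝ)) S.trace := by
  obtain ⟨l, B, rfl⟩ := Matrix.posSemidef_iff_eq_sum_vecMulVec.1 hS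
  set J : Matrix (Fin m) (Fin n) ℝ := diagRect fun _ => 1 with hJ
  have h1 : (∑ k, vecMulVec (B k) (star (B k))) * J = ∑ k, vecMulVec (B k) (B k ᵥ* J) := by
    simp [Matrix.sum_mul, vecMulVec_mul]
  have h2 : (∑ k, vecMulVec (B k) (star (B k))).trace =
      ∑ k, (B k ⬝ᵥ B k + (B k ᵥ* J) ⬝ᵥ (B k ᵥ* J)) / 2 := by
    have hk : ∀ k, (B k ᵥ* J) ⬝ᵥ (B k ᵥ* J) = B k ⬝ᵥ B k := by
      intro k
      rw [dotProduct, sum_eq_sum_castLE hmn]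
      · simp [hJ, vecMul_diagRect_castLE hmn, dotProduct]
      · intro j hj
        rw [hJ, vecMul_diagRect_of_le _ _ hj, zero_mul]
    simp [hk, Matrix.trace_sum, trace_vecMulVec]
  rw [h1, h2]
  exact NuclearLE.sum _ _ _ fun k _ => NuclearLE.vecMulVec _ _

lemma nuclearLE_quadratic (hmn : m ≤ n) {w : Fin m → ℝ} (hw : ∀ k, 0 ≤ w k)
    (hw1 : ∑ k, w k = 1) {D : Matrix (Fin m) (Fin n) ℝ} {S : Matrix (Fin m) (Fin m) ℝ}
    (hS : S.PosSemidef) (hSD : ∀ i k, w i = 0 → w k = 0 → D i (Fin.castLE hmn k) = S i k)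
    (hS0 : ∀ i k, w i ≠ 0 ∨ w k ≠ 0 → S i k = 0)
    (hD0 : ∀ i (j : Fin n), w i = 0 → m ≤ (j : ℕ) → D i j = 0)
    (htr : ∑ i, (if w i = 0 then 0 else D i (Fin.castLE hmn i)) + S.trace = 0) :
    ∃ C : ℝ, 0 ≤ C ∧ ∀ t : ℝ, 0 < t →
      NuclearLE ((diagRect w : Matrix (Fin m) (Fin n) ℝ) + t • D) (1 + C * t ^ 2) := by
  set a : Fin m → Fin m → ℝ := fun k i =>
    (if w i = 0 then 1 else 1 / 2) * D i (Fin.castLE hmn k) / w k with ha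
  set h : Fin n → ℝ := fun j =>
    if hj : (j : ℕ) < m then (if w ⟨j, hj⟩ = 0 then 1 else 1 / 2) else 1 with hh
  set b : Fin m → Fin n → ℝ := fun k j => h j * D k j / w k with hb
  set e : Fin m → Fin m → ℝ := fun k => Pi.single k 1 with he
  set f : Fin m → Fin n → ℝ := fun k => Pi.single (Fin.castLE hmn k) 1 with hf
  set J : Matrix (Fin m) (Fin n) ℝ := diagRect fun _ => 1 with hJ
  have hcast : ∀ k, h (Fin.castLE hmn k) = if w k = 0 then 1 else 1 / 2 := by
    intro k
    simp [hh]
  have hDdec : D = ∑ k, w k • (vecMulVec (a k) (f k) + vecMulVec (e k) (b k)) + S * J := by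
    have hSJ : ∀ i (j : Fin n), (S * J) i j = (S i ᵥ* J) j := fun i j => rfl
    ext i j
    rw [Matrix.add_apply, Matrix.sum_apply]
    simp only [Matrix.smul_apply, Matrix.add_apply, vecMulVec_apply, smul_eq_mul, mul_add,
      Finset.sum_add_distrib]
    have h2 : ∑ k, w k * (e k i * b k j) = w i * b i j := by
      rw [Finset.sum_eq_single i]
      · simp [he]
      · intro k _ hk
        simp [he, hk.symm]
      · simp
    rw [h2, hSJ]
    rcases eq_castLE_or_le hmn j with ⟨l, rfl⟩ | hj
    · have h1 : ∑ k, w k * (a k i * f k (Fin.castLE hmn l)) = w l * a l i := by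
        rw [Finset.sum_eq_single l]
        · simp [hf]
        · intro k _ hk
          have : Fin.castLE hmn l ≠ Fin.castLE hmn k :=
            fun e => hk (Fin.castLE_injective hmn e).symm
          simp [hf, this]
        · simp
      rw [h1, hJ, vecMul_diagRect_castLE hmn, mul_one]
      simp only [ha, hb, hcast]
      by_cases hi : w i = 0 <;> by_cases hl : w l = 0
      · simp [hi, hl, hSD i l hi hl]
      · rw [hS0 i l (Or.inr hl)]
        simp [hi, hl]
        field_simp
      · rw [hS0 i l (Or.inl hi)]
        simp [hi, hl]
        field_simp
      · rw [hS0 i l (Or.inl hi)]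
        simp [hi, hl]
        field_simp
        ring
    · have h1 : ∑ k, w k * (a k i * f k j) = 0 := by
        refine Finset.sum_eq_zero fun k _ => ?_
        have : j ≠ Fin.castLE hmn k := by
          rintro rfl
          simp at hj
          omega
        simp [hf, this]
      rw [h1, hJ, vecMul_diagRect_of_le _ _ hj]
      by_cases hi : w i = 0
      · simp [hi, hD0 i j hi hj]
      · have : h j = 1 := by simp [hh, not_lt.2 hj]
        simp only [hb, this]
        field_simp
        ring
  have hsum : ∑ k, w k * (a k k + b k (Fin.castLE hmn k))
      = ∑ i, (if w i = 0 then 0 else D i (Fin.castLE hmn i)) := by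
    refine Finset.sum_congr rfl fun k _ => ?_
    simp only [ha, hb, hcast]
    by_cases hk : w k = 0
    · simp [hk]
    · simp only [hk, if_false]
      field_simp
      ring
  set C₁ := ∑ k, w k * ((a k ⬝ᵥ a k + b k ⬝ᵥ b k) / 2) with hC₁
  set C₂ := ∑ k, (((-w k) • a k) ⬝ᵥ ((-w k) • a k) + b k ⬝ᵥ b k) / 2 with hC₂
  have hC₁0 : 0 ≤ C₁ := Finset.sum_nonneg fun k _ => by
    have h1 := dotProduct_self_nonneg' (a k)
    have h2 := dotProduct_self_nonneg' (b k)
    have h3 := hw k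
    positivity
  have hC₂0 : 0 ≤ C₂ := Finset.sum_nonneg fun k _ => by
    have h1 := dotProduct_self_nonneg' ((-w k) • a k)
    have h2 := dotProduct_self_nonneg' (b k)
    positivity
  refine ⟨C₁ + C₂, add_nonneg hC₁0 hC₂0, fun t ht => ?_⟩
  have hdec : (diagRect w : Matrix (Fin m) (Fin n) ℝ) + t • D =
      ∑ k, w k • vecMulVec (e k + t • a k) (f k + t • b k) + t • (S * J)
        + t ^ 2 • ∑ k, vecMulVec ((-w k) • a k) (b k) := by
    have hk : ∀ k, w k • vecMulVec (e k + t • a k) (f k + t • b k) =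
        w k • vecMulVec (e k) (f k) +
          t • (w k • (vecMulVec (a k) (f k) + vecMulVec (e k) (b k))) -
          t ^ 2 • vecMulVec ((-w k) • a k) (b k) := by
      intro k
      ext i j
      simp [vecMulVec_apply]
      ring
    conv_lhs => rw [hDdec, diagRect_eq_sum hmn]
    simp only [hk, Finset.sum_sub_distrib, Finset.sum_add_distrib, Finset.smul_sum, smul_add]
    abel
  rw [hdec]
  have h1 : NuclearLE (∑ k, w k • vecMulVec (e k + t • a k) (f k + t • b k))
      (1 + t * ∑ i, (if w i = 0 then 0 else D i (Fin.castLE hmn i)) + t ^ 2 * C₁) := by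
    have heq : 1 + t * ∑ i, (if w i = 0 then 0 else D i (Fin.castLE hmn i)) + t ^ 2 * C₁ =
        ∑ k, w k * (((e k + t • a k) ⬝ᵥ (e k + t • a k) +
          (f k + t • b k) ⬝ᵥ (f k + t • b k)) / 2) := by
      rw [← hsum, ← hw1, hC₁, Finset.mul_sum, Finset.mul_sum, ← Finset.sum_add_distrib,
        ← Finset.sum_add_distrib]
      refine Finset.sum_congr rfl fun k _ => ?_
      simp [he, hf]
      ring
    rw [heq]
    exact NuclearLE.sum _ _ _ fun k _ => (NuclearLE.vecMulVec _ _).smul (hw k)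
  have h2 := (nuclearLE_posSemidef_mul hmn hS).smul ht.le
  have h3 : NuclearLE (∑ k, vecMulVec ((-w k) • a k) (b k)) C₂ :=
    NuclearLE.sum _ _ _ fun k _ => NuclearLE.vecMulVec _ _
  refine ((h1.add h2).add (h3.smul (sq_nonneg t))).mono (le_of_eq ?_)
  have : t * (∑ i, (if w i = 0 then 0 else D i (Fin.castLE hmn i)) + S.trace) = 0 := by
    rw [htr, mul_zero]
  linear_combination this

end Sufficiency

/-- Proposition 3.1 (ii): characterization of the critical cone
`C_{θ*}(W,P)` of the conjugate of the spectral norm. -/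
theorem critThetaStar_mem_iff {m n : ℕ} (hmn : m ≤ n)
    (P W : Matrix (Fin m) (Fin n) ℝ) (hP : P ≠ 0)
    (hW : W ∈ subdiff specNorm P)
    (U : Matrix (Fin m) (Fin m) ℝ) (V : Matrix (Fin n) (Fin n) ℝ) (σ : Fin m → ℝ)
    (hU : Uᵀ * U = 1) (hV : Vᵀ * V = 1)
    (hσa : Antitone σ) (hσ0 : ∀ i, 0 ≤ σ i)
    (hSVD : P + W = U * (diagRect σ : Matrix (Fin m) (Fin n) ℝ) * Vᵀ)
    (lam : ℝ) (hlam0 : 0 < lam) (hlamP : lam = specNorm P)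
    (hlam1 : ∑ i, max (σ i - lam) 0 = 1)
    (hPdec : P = U * (diagRect (fun i => min (σ i) lam) : Matrix (Fin m) (Fin n) ℝ) * Vᵀ)
    (hWdec : W = U * (diagRect (fun i => max (σ i - lam) 0) : Matrix (Fin m) (Fin n) ℝ) * Vᵀ)
    (D : Matrix (Fin m) (Fin n) ℝ) :
    D ∈ critThetaStar W P ↔
      -- trace(D̃_{αα}) = 0
      ((∑ i, if lam ≤ σ i then (Uᵀ * D * V) i (Fin.castLE hmn i) else 0) = 0 ∧
      -- S(D̃_{α₁α₁}) negative semidefinite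
      (∀ x : Fin m → ℝ, (∀ i, σ i ≠ lam + 1 → x i = 0) →
        quadForm (symLeft hmn (Uᵀ * D * V)) x ≤ 0) ∧
      -- D̃_{α₃α₃} symmetric positive semidefinite
      (∀ i j : Fin m, σ i = lam → σ j = lam →
        (Uᵀ * D * V) i (Fin.castLE hmn j) = (Uᵀ * D * V) j (Fin.castLE hmn i)) ∧
      (∀ x : Fin m → ℝ, (∀ i, σ i ≠ lam → x i = 0) →
        0 ≤ ∑ i, ∑ j, x i * (Uᵀ * D * V) i (Fin.castLE hmn j) * x j) ∧
      -- D̃_{α₃β} = 0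
      (∀ i j : Fin m, σ i = lam → σ j < lam → (Uᵀ * D * V) i (Fin.castLE hmn j) = 0) ∧
      -- D̃_{α₃c} = 0
      (∀ i : Fin m, σ i = lam → ∀ j : Fin n, m ≤ (j : ℕ) → (Uᵀ * D * V) i j = 0) ∧
      -- D̃_{βα₃} = 0
      (∀ i j : Fin m, σ i < lam → σ j = lam → (Uᵀ * D * V) i (Fin.castLE hmn j) = 0) ∧
      -- D̃_{ββ} = 0
      (∀ i j : Fin m, σ i < lam → σ j < lam → (Uᵀ * D * V) i (Fin.castLE hmn j) = 0) ∧
      -- D̃_{βc} = 0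
      (∀ i : Fin m, σ i < lam → ∀ j : Fin n, m ≤ (j : ℕ) → (Uᵀ * D * V) i j = 0)) := by
  set A := Uᵀ * D * V with hA
  set w : Fin m → ℝ := fun i => max (σ i - lam) 0 with hw
  set p : Fin m → ℝ := fun i => min (σ i) lam / lam with hp
  have hU' : U * Uᵀ = 1 := mul_eq_one_comm.1 hU
  have hV' : V * Vᵀ = 1 := mul_eq_one_comm.1 hV
  have hw0 : ∀ i, 0 ≤ w i := fun i => le_max_right _ _
  have hwz : ∀ i, w i = 0 ↔ σ i ≤ lam := fun i => by simp [hw]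
  have hp0 : ∀ i, 0 ≤ p i := fun i => div_nonneg (le_min (hσ0 i) hlam0.le) hlam0.le
  have hp1 : ∀ i, p i ≤ 1 := fun i => (div_le_one hlam0).2 (min_le_right _ _)
  have hplt : ∀ i, σ i < lam → p i < 1 := fun i hi => by
    simp only [hp, min_eq_left hi.le]
    exact (div_lt_one hlam0).2 hi
  have hpeq : ∀ i, lam ≤ σ i → p i = 1 := fun i hi => by
    simp only [hp, min_eq_right hi, div_self hlam0.ne']
  have hWB : NuclearLE W 1 := by
    have h := nuclearLE_diagRect hmn hw0
    rw [hlam1] at h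
    rw [hWdec]
    exact h.rotate hU hV zero_le_one
  have hDP : minner D P = lam * ∑ i, p i * A i (Fin.castLE hmn i) := by
    rw [minner_comm, hPdec, minner_rotate, minner_comm, minner_diagRect hmn, ← hA,
      Finset.mul_sum]
    refine Finset.sum_congr rfl fun i _ => ?_
    simp only [hp]
    field_simp
  have hDP0 : minner D P = 0 ↔ ∑ i, p i * A i (Fin.castLE hmn i) = 0 := by
    rw [hDP, mul_eq_zero, or_iff_right hlam0.ne']
  rw [mem_critThetaStar_iff hWB, hDP0]
  constructor
  · rintro ⟨hT, hzero⟩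
    have hZ : ∀ Z : Matrix (Fin m) (Fin n) ℝ, specNorm Z ≤ 1 → minner (diagRect w) Z = 1 →
        minner A Z ≤ 0 := by
      intro Z hZ1 hZ2
      have h := minner_nonpos_of_mem_nuclearTangent (Z := U * Z * Vᵀ) hT
        ((specNorm_rotate_le hU (by rwa [transpose_transpose]) Z).trans hZ1) (by
          rw [hWdec, minner_rotate, ← hZ2]
          congr 1
          rw [← Matrix.mul_assoc, ← Matrix.mul_assoc, hU, Matrix.one_mul, Matrix.mul_assoc, hV,
            Matrix.mul_one])
      rwa [minner_comm, minner_rotate, minner_comm] at h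
    have hwp : minner (diagRect w : Matrix (Fin m) (Fin n) ℝ) (diagRect p) = 1 := by
      rw [minner_diagRect hmn, ← hlam1]
      refine Finset.sum_congr rfl fun i _ => ?_
      rw [diagRect_apply_castLE hmn, if_pos rfl]
      by_cases hi : σ i ≤ lam
      · rw [(hwz i).2 hi, mul_zero]
      · rw [hpeq i (not_le.1 hi).le, one_mul]
    have hsupp : ∀ i (y : ℝ), (¬ σ i ≤ lam → y = 0) → y * w i = 0 := by
      intro i y hy
      by_cases hi : σ i ≤ lam
      · rw [(hwz i).2 hi, mul_zero]
      · rw [hy hi, zero_mul]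
    have hCT : ContractionTest hmn A p fun i => σ i ≤ lam := by
      intro u v s hu hv hFu hFv hs
      refine contraction_test
        (diagRect_contraction hmn fun i => pow_le_one₀ (hp0 i) (hp1 i)) hwp ?_ hZ hu hv ?_ ?_ hs
      · rw [minner_diagRect hmn, hzero]
      · ext j
        rcases eq_castLE_or_le hmn j with ⟨k, rfl⟩ | hj
        · rw [vecMul_diagRect_castLE hmn]
          exact hsupp k _ (hFu k)
        · rw [vecMul_diagRect_of_le _ _ hj, Pi.zero_apply]
      · rw [diagRect_mulVec hmn]
        ext i
        rw [mul_comm]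
        exact hsupp i _ (hFv i)
    have hpsd : ∀ x : Fin m → ℝ, (∀ i, σ i ≠ lam → x i = 0) →
        0 ≤ ∑ i, ∑ j, x i * A i (Fin.castLE hmn j) * x j := by
      intro x hx
      refine hCT.quadratic_nonneg (fun i hi => hx i fun e => hi e.le) fun i hi => ?_
      by_contra hne
      exact hi (hx i fun e => hne (hpeq i e.ge))
    have htrace : (∑ i, if lam ≤ σ i then A i (Fin.castLE hmn i) else 0) = 0 := by
      refine Eq.trans ?_ hzero
      refine Finset.sum_congr rfl fun i _ => ?_
      split_ifs with hi
      · rw [hpeq i hi, one_mul]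
      · have hi' := not_le.1 hi
        rw [hCT.diag_eq_zero hi'.le (hp0 i) (hplt i hi'), mul_zero]
    have hdiag : ∀ i, σ i = lam → 0 ≤ A i (Fin.castLE hmn i) := by
      intro i hi
      have h := hpsd (Pi.single i 1) fun k hk =>
        Pi.single_eq_of_ne (fun e : k = i => hk (e ▸ hi)) 1
      simpa [Pi.single_apply] using h
    have hcross : ∀ i j : Fin m, σ i = lam → σ j < lam →
        A i (Fin.castLE hmn j) = 0 ∧ A j (Fin.castLE hmn i) = 0 := by
      intro i j hi hj
      have hij : i ≠ j := by
        rintro rfl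
        exact hj.ne hi
      have h1 := hCT.row_eq hi.le hj.le (hpeq i hi.ge) hij
      have h2 := hCT.col_eq hi.le hj.le (hpeq i hi.ge) hij
      have h3 : (1 - p j ^ 2) * A i (Fin.castLE hmn j) = 0 := by
        rw [h2] at h1
        linear_combination h1
      have h4 : 1 - p j ^ 2 ≠ 0 := by nlinarith [hp0 j, hplt j hj]
      have h5 := (mul_eq_zero.1 h3).resolve_left h4
      exact ⟨h5, by rw [h2, h5, mul_zero]⟩
    refine ⟨htrace, ?_, ?_, hpsd, fun i j hi hj => (hcross i j hi hj).1,
      fun i hi j hj => hCT.row_trailing_eq_zero hi.le (hpeq i hi.ge) hj,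
      fun i j hi hj => (hcross j i hj hi).2,
      fun i j hi hj => hCT.offDiag_eq_zero hi.le hj.le (hp0 i) (hplt i hi) (hp0 j) (hplt j hj),
      fun i hi j hj => hCT.trailing_eq_zero hi.le (hp0 i) (hplt i hi) hj⟩
    · intro x hx
      by_cases hex : ∃ k, σ k = lam + 1
      · obtain ⟨k, hk⟩ := hex
        have hwk : w k = 1 := by simp [hw, hk]
        have hle : ∀ i, i ≠ k → σ i ≤ lam := by
          have hrest : ∑ i ∈ Finset.univ.erase k, w i = 0 := by
            have h := Finset.add_sum_erase Finset.univ w (Finset.mem_univ k)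
            rw [hlam1, hwk] at h
            linarith
          intro i hi
          exact (hwz i).1 ((Finset.sum_eq_zero_iff_of_nonneg fun i _ => hw0 i).1 hrest i
            (Finset.mem_erase.2 ⟨hi, Finset.mem_univ i⟩))
        have hx0 : ∀ i, i ≠ k → x i = 0 := fun i hi =>
          hx i fun e => by linarith [hle i hi]
        have hform : quadForm (symLeft hmn A) x = x k ^ 2 * A k (Fin.castLE hmn k) := by
          rw [quadForm, Finset.sum_eq_single k, Finset.sum_eq_single k]
          · simp only [symLeft, Matrix.of_apply]
            ring
          · intro j _ hj
            rw [hx0 j hj, mul_zero]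
          · simp
          · intro i _ hi
            simp [hx0 i hi]
          · simp
        have hneg : A k (Fin.castLE hmn k) ≤ 0 := by
          have h := Finset.add_sum_erase Finset.univ
            (fun i => if lam ≤ σ i then A i (Fin.castLE hmn i) else 0) (Finset.mem_univ k)
          rw [htrace] at h
          have hnn : 0 ≤ ∑ i ∈ Finset.univ.erase k,
              if lam ≤ σ i then A i (Fin.castLE hmn i) else 0 := by
            refine Finset.sum_nonneg fun i hi => ?_
            split_ifs with hl
            · exact hdiag i (le_antisymm (hle i (Finset.ne_of_mem_erase hi)) hl)
            · exact le_rfl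
          have hkl : lam ≤ σ k := by linarith
          simp only [hkl, if_true] at h
          linarith
        rw [hform]
        exact mul_nonpos_of_nonneg_of_nonpos (sq_nonneg _) hneg
      · push Not at hex
        have hx0 : ∀ i, x i = 0 := fun i => hx i (hex i)
        simp [quadForm, hx0]
    · intro i j hi hj
      by_cases hij : i = j
      · rw [hij]
      · rw [hCT.row_eq hi.le hj.le (hpeq i hi.ge) hij, hpeq j hj.ge, one_mul]
  · rintro ⟨htrace, -, hsymm, hpsd, hab, hac, hba, hbb, hbc⟩
    have hsplit : ∀ i, w i = 0 → σ i = lam ∨ σ i < lam := fun i hi =>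
      ((hwz i).1 hi).eq_or_lt
    constructor
    · set S : Matrix (Fin m) (Fin m) ℝ := Matrix.of fun i j =>
        if σ i = lam ∧ σ j = lam then A i (Fin.castLE hmn j) else 0 with hS
      have hSpsd : S.PosSemidef := by
        refine Matrix.PosSemidef.of_dotProduct_mulVec_nonneg ?_ fun x => ?_
        · refine Matrix.IsHermitian.ext fun i j => ?_
          simp only [hS, Matrix.of_apply, star_trivial]
          by_cases h : σ i = lam ∧ σ j = lam
          · rw [if_pos h, if_pos h.symm, hsymm i j h.1 h.2]
          · rw [if_neg h, if_neg fun hs => h hs.symm]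
        · have h := hpsd (fun i => if σ i = lam then x i else 0) fun i hi => if_neg hi
          refine h.trans_eq ?_
          simp only [dotProduct, mulVec, hS, Matrix.of_apply, star_trivial, Finset.mul_sum]
          refine Finset.sum_congr rfl fun i _ => Finset.sum_congr rfl fun j _ => ?_
          by_cases hi : σ i = lam <;> by_cases hj : σ j = lam <;> simp [hi, hj, mul_assoc]
      obtain ⟨C, hC, hquad⟩ := nuclearLE_quadratic hmn hw0 hlam1 (D := A) hSpsd
        (by
          intro i k hi hk
          simp only [hS, Matrix.of_apply]
          rcases hsplit i hi with h1 | h1 <;> rcases hsplit k hk with h2 | h2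
          · rw [if_pos ⟨h1, h2⟩]
          · rw [if_neg fun h => h2.ne h.2, hab i k h1 h2]
          · rw [if_neg fun h => h1.ne h.1, hba i k h1 h2]
          · rw [if_neg fun h => h1.ne h.1, hbb i k h1 h2])
        (by
          intro i k hik
          simp only [hS, Matrix.of_apply]
          refine if_neg fun h => ?_
          rcases hik with hi | hk
          · exact hi ((hwz i).2 h.1.le)
          · exact hk ((hwz k).2 h.2.le))
        (by
          intro i j hi hj
          rcases hsplit i hi with h1 | h1
          · exact hac i h1 j hj
          · exact hbc i h1 j hj)
        (by
          refine Eq.trans ?_ htrace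
          rw [Matrix.trace, ← Finset.sum_add_distrib]
          refine Finset.sum_congr rfl fun i _ => ?_
          simp only [hS, Matrix.diag_apply, Matrix.of_apply, hwz, and_self]
          rcases lt_trichotomy (σ i) lam with h | h | h
          · simp [h.le, h.ne, h.not_ge]
          · simp [h]
          · simp [h.le, h.ne', h.not_ge])
      refine mem_nuclearTangent_of_quadratic hC fun t ht => ?_
      have h := (hquad t ht).rotate hU hV (by positivity)
      have heq : U * ((diagRect w : Matrix (Fin m) (Fin n) ℝ) + t • A) * Vᵀ = W + t • D := by
        rw [Matrix.mul_add, Matrix.add_mul, ← hWdec, Matrix.mul_smul, Matrix.smul_mul, hA]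
        congr 2
        rw [← Matrix.mul_assoc, ← Matrix.mul_assoc, hU', Matrix.one_mul, Matrix.mul_assoc, hV',
          Matrix.mul_one]
      rwa [heq] at h
    · refine Eq.trans ?_ htrace
      refine Finset.sum_congr rfl fun i _ => ?_
      split_ifs with hi
      · rw [hpeq i hi, one_mul]
      · rw [hbb i i (not_le.1 hi) (not_le.1 hi), mul_zero]
end

section
/- Let W ∈ ∂θ(P) with P ≠ 0 and Q = P + W with SVD as in the context. Then: (a) the index sets α₁ and α₂ cannot both be nonempty, and if α₁ ≠ ∅ then |α₁| = 1 and α₂ = ∅; (b) D ∈ C_θ(P,W) if and only if S(D̃_{αα}) equals the block-diagonal matrix Diag( λ₁(S(D̃_{αα}))·I_{|α₁|+|α₂|}, S(D̃_{α₃α₃}) ), i.e., the parameter τ in the characterization of C_θ(P,W) can always be taken to be the largest eigenvalue of S(D̃_{αα}). -/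
open Matrix Filter Set RealInnerProductSpace

noncomputable section

/-- Largest eigenvalue of the principal submatrix of `A` indexed by `{i | p i}`,
via the Rayleigh quotient characterization. -/
def maxEigOn {m : ℕ} (A : Matrix (Fin m) (Fin m) ℝ) (p : Fin m → Prop) : ℝ :=
  sSup {r | ∃ x : Fin m → ℝ, (∀ i, ¬ p i → x i = 0) ∧ ∑ i, x i ^ 2 = 1 ∧ r = quadForm A x}

section UnitVectors

variable {ι κ : Type*} [Fintype ι] [Fintype κ]

lemma abs_le_one_of_sum_sq_eq_one {u : ι → ℝ} (hu : ∑ i, u i ^ 2 = 1) (i : ι) : |u i| ≤ 1 := by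
  have h : u i ^ 2 ≤ ∑ i, u i ^ 2 :=
    Finset.single_le_sum (f := fun i => u i ^ 2) (fun i _ => sq_nonneg _) (Finset.mem_univ i)
  exact (sq_le_one_iff_abs_le_one _).mp (hu ▸ h)

lemma isCompact_unitSphere : IsCompact {u : ι → ℝ | ∑ i, u i ^ 2 = 1} := by
  refine Metric.isCompact_of_isClosed_isBounded
    (isClosed_eq (by fun_prop) continuous_const) ?_
  refine (Metric.isBounded_closedBall (x := (0 : ι → ℝ)) (r := 1)).subset fun u hu => ?_
  rw [mem_closedBall_zero_iff, pi_norm_le_iff_of_nonneg zero_le_one]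
  exact fun i => abs_le_one_of_sum_sq_eq_one hu i

lemma sum_sq_mulVec_of_orthogonal [DecidableEq ι] {O : Matrix ι ι ℝ} (hO : Oᵀ * O = 1)
    (u : ι → ℝ) : ∑ i, (O *ᵥ u) i ^ 2 = ∑ i, u i ^ 2 := by
  have h : (O *ᵥ u) ⬝ᵥ (O *ᵥ u) = u ⬝ᵥ u := by
    rw [dotProduct_mulVec, ← mulVec_transpose, mulVec_mulVec, hO, one_mulVec]
  simpa [dotProduct, pow_two] using h

lemma bilin_le_sqrt {A : Matrix ι κ ℝ} {u : ι → ℝ} (y : κ → ℝ) (hu : ∑ i, u i ^ 2 = 1) :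
    u ⬝ᵥ A *ᵥ y ≤ Real.sqrt (∑ i, (∑ j, A i j * y j) ^ 2) := by
  refine Real.le_sqrt_of_sq_le ?_
  have h := Finset.sum_mul_sq_le_sq_mul_sq Finset.univ u (A *ᵥ y)
  rw [hu, one_mul] at h
  exact h

lemma bddAbove_specNorm (A : Matrix ι κ ℝ) :
    BddAbove {r : ℝ | ∃ x : κ → ℝ, ∑ j, x j ^ 2 = 1 ∧
      r = Real.sqrt (∑ i, (∑ j, A i j * x j) ^ 2)} := by
  have h := (isCompact_unitSphere (ι := κ)).bddAbove_image
    (f := fun x => Real.sqrt (∑ i, (∑ j, A i j * x j) ^ 2)) (by fun_prop)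
  refine h.mono ?_
  rintro r ⟨x, hx, rfl⟩
  exact ⟨x, hx, rfl⟩

lemma bilin_le_specNorm {A : Matrix ι κ ℝ} {u : ι → ℝ} {y : κ → ℝ}
    (hu : ∑ i, u i ^ 2 = 1) (hy : ∑ j, y j ^ 2 = 1) : u ⬝ᵥ A *ᵥ y ≤ specNorm A :=
  (bilin_le_sqrt y hu).trans (le_csSup (bddAbove_specNorm A) ⟨y, hy, rfl⟩)

lemma specNorm_le_of_bilin_le {A : Matrix ι κ ℝ} {c : ℝ} (hc : 0 ≤ c)
    (h : ∀ (u : ι → ℝ) (y : κ → ℝ), ∑ i, u i ^ 2 = 1 → ∑ j, y j ^ 2 = 1 → u ⬝ᵥ A *ᵥ y ≤ c) :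
    specNorm A ≤ c := by
  refine Real.sSup_le ?_ hc
  rintro r ⟨y, hy, rfl⟩
  set s : ℝ := ∑ i, (∑ j, A i j * y j) ^ 2 with hs
  have hs0 : 0 ≤ s := Finset.sum_nonneg fun i _ => sq_nonneg _
  rcases hs0.eq_or_lt with h0 | h0
  · rw [← h0, Real.sqrt_zero]; exact hc
  have hr : 0 < Real.sqrt s := Real.sqrt_pos.mpr h0
  have hAy : (A *ᵥ y) ⬝ᵥ A *ᵥ y = s := by
    rw [hs]; simp only [dotProduct, mulVec, pow_two]
  have hun : ∑ i, ((Real.sqrt s)⁻¹ • A *ᵥ y) i ^ 2 = 1 := by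
    have : ∑ i, ((Real.sqrt s)⁻¹ • A *ᵥ y) i ^ 2 = ((Real.sqrt s)⁻¹) ^ 2 * s := by
      rw [hs, Finset.mul_sum]
      exact Finset.sum_congr rfl fun i _ => by
        simp only [Pi.smul_apply, smul_eq_mul, mulVec, dotProduct, mul_pow]
    rw [this, inv_pow, Real.sq_sqrt hs0, inv_mul_cancel₀ h0.ne']
  have := h _ y hun hy
  rw [smul_dotProduct, hAy, smul_eq_mul] at this
  rwa [inv_mul_eq_div, Real.div_sqrt] at this

/-- Danskin's formula for the spectral norm: the one-sided directional derivative is the supremum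
of `uᵀ D y` over the pairs of unit vectors at which `uᵀ P y` attains the norm. -/
lemma dirDeriv_specNorm_eq {P D : Matrix ι κ ℝ} {μ : ℝ} (hP : 0 < specNorm P)
    (hle : ∀ (u : ι → ℝ) (y : κ → ℝ), ∑ i, u i ^ 2 = 1 → ∑ j, y j ^ 2 = 1 →
      u ⬝ᵥ P *ᵥ y = specNorm P → u ⬝ᵥ D *ᵥ y ≤ μ)
    (hge : ∀ t : ℝ, 0 < t → specNorm P + t * μ ≤ specNorm (P + t • D)) :
    dirDeriv specNorm P D = μ := by
  have hB (A : Matrix ι κ ℝ) :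
      Continuous fun p : (ι → ℝ) × (κ → ℝ) => p.1 ⬝ᵥ A *ᵥ p.2 := by
    simp only [dotProduct, mulVec]; fun_prop
  set K : Set ((ι → ℝ) × (κ → ℝ)) := {u | ∑ i, u i ^ 2 = 1} ×ˢ {y | ∑ j, y j ^ 2 = 1} with hK
  have hKc : IsCompact K := isCompact_unitSphere.prod isCompact_unitSphere
  obtain ⟨C, hC⟩ := hKc.bddAbove_image (hB D).continuousOn
  have hub : ∀ ε > 0, ∀ᶠ t in nhdsWithin (0 : ℝ) (Ioi 0),
      specNorm (P + t • D) ≤ specNorm P + t * (μ + ε) := by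
    intro ε hε
    set L : Set ((ι → ℝ) × (κ → ℝ)) := K ∩ {p | μ + ε ≤ p.1 ⬝ᵥ D *ᵥ p.2} with hL
    have hLc : IsCompact L := hKc.inter_right (isClosed_le continuous_const (hB D))
    have hgap : ∃ δ > 0, ∀ p ∈ L, p.1 ⬝ᵥ P *ᵥ p.2 ≤ specNorm P - δ := by
      rcases L.eq_empty_or_nonempty with h0 | h0
      · exact ⟨1, one_pos, by simp [h0]⟩
      · obtain ⟨p, hp, hmax⟩ := hLc.exists_isMaxOn h0 (hB P).continuousOn
        refine ⟨specNorm P - p.1 ⬝ᵥ P *ᵥ p.2, ?_, fun q hq => ?_⟩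
        · have h1 := bilin_le_specNorm (A := P) hp.1.1 hp.1.2
          have h2 : p.1 ⬝ᵥ P *ᵥ p.2 ≠ specNorm P := fun h => by
            have h3 := hle _ _ hp.1.1 hp.1.2 h
            have h4 : μ + ε ≤ p.1 ⬝ᵥ D *ᵥ p.2 := hp.2
            linarith
          exact sub_pos.mpr (lt_of_le_of_ne h1 h2)
        · have : q.1 ⬝ᵥ P *ᵥ q.2 ≤ p.1 ⬝ᵥ P *ᵥ p.2 := hmax hq
          linarith
    obtain ⟨δ, hδ, hgap⟩ := hgap
    have hsmall (a b : ℝ) (hb : 0 < b) : ∀ᶠ t in nhdsWithin (0 : ℝ) (Ioi 0), t * a < b := by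
      have : Tendsto (fun t : ℝ => t * a) (nhds 0) (nhds 0) :=
        Continuous.tendsto' (by fun_prop) _ _ (zero_mul a)
      exact (this.mono_left nhdsWithin_le_nhds).eventually_lt_const hb
    filter_upwards [self_mem_nhdsWithin, hsmall (C - (μ + ε)) δ hδ, hsmall (-(μ + ε)) _ hP]
      with t ht h1 h2
    have ht : 0 < t := ht
    refine specNorm_le_of_bilin_le (by linarith) fun u y hu hy => ?_
    rw [add_mulVec, smul_mulVec, dotProduct_add, dotProduct_smul, smul_eq_mul]
    by_cases hd : μ + ε ≤ u ⬝ᵥ D *ᵥ y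
    · have h3 := hgap (u, y) ⟨⟨hu, hy⟩, hd⟩
      have h4 : u ⬝ᵥ D *ᵥ y ≤ C := hC ⟨(u, y), ⟨hu, hy⟩, rfl⟩
      have h5 := mul_le_mul_of_nonneg_left h4 ht.le
      simp only at h3
      linarith
    · have h3 := bilin_le_specNorm (A := P) hu hy
      have h4 := mul_le_mul_of_nonneg_left (not_le.mp hd).le ht.le
      linarith
  refine Tendsto.limUnder_eq ?_
  rw [Metric.tendsto_nhds]
  intro ε hε
  filter_upwards [self_mem_nhdsWithin, hub (ε / 2) (half_pos hε)] with t ht h1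
  have ht : 0 < t := ht
  have h2 := hge t ht
  have h3 : μ ≤ (specNorm (P + t • D) - specNorm P) / t := by
    rw [le_div_iff₀ ht]; linarith
  have h4 : (specNorm (P + t • D) - specNorm P) / t ≤ μ + ε / 2 := by
    rw [div_le_iff₀ ht]; linarith
  rw [Real.dist_eq, abs_lt]
  constructor <;> linarith

end UnitVectors

section MaxEig

variable {m : ℕ} {A : Matrix (Fin m) (Fin m) ℝ} {p : Fin m → Prop}

lemma quadForm_le_maxEigOn {x : Fin m → ℝ} (hx : ∀ i, ¬ p i → x i = 0)
    (hx1 : ∑ i, x i ^ 2 = 1) : quadForm A x ≤ maxEigOn A p := by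
  refine le_csSup ?_ ⟨x, hx, hx1, rfl⟩
  have h := (isCompact_unitSphere (ι := Fin m)).bddAbove_image (f := quadForm A)
    (by unfold quadForm; fun_prop)
  refine h.mono ?_
  rintro r ⟨x, -, hx, rfl⟩
  exact ⟨x, hx, rfl⟩

lemma quadForm_smul (c : ℝ) (x : Fin m → ℝ) : quadForm A (c • x) = c ^ 2 * quadForm A x := by
  simp only [quadForm, Finset.mul_sum, Pi.smul_apply, smul_eq_mul]
  exact Finset.sum_congr rfl fun i _ => Finset.sum_congr rfl fun j _ => by ring

lemma quadForm_le_maxEigOn_mul {x : Fin m → ℝ} (hx : ∀ i, ¬ p i → x i = 0) :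
    quadForm A x ≤ maxEigOn A p * ∑ i, x i ^ 2 := by
  set s := ∑ i, x i ^ 2 with hs
  have hs0 : 0 ≤ s := Finset.sum_nonneg fun i _ => sq_nonneg _
  rcases hs0.eq_or_lt with h0 | h0
  · have hx0 : ∀ i, x i = 0 := fun i => by
      have := (Finset.sum_eq_zero_iff_of_nonneg fun i _ => sq_nonneg (x i)).mp
        (hs.symm.trans h0.symm) i (Finset.mem_univ i)
      exact pow_eq_zero_iff two_ne_zero |>.mp this
    simp [quadForm, hx0, ← h0]
  · have h := quadForm_le_maxEigOn (A := A) (p := p) (x := (Real.sqrt s)⁻¹ • x)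
      (fun i hi => by simp [hx i hi]) (by
        simp only [Pi.smul_apply, smul_eq_mul, mul_pow]
        rw [← Finset.mul_sum, ← hs, inv_pow, Real.sq_sqrt hs0, inv_mul_cancel₀ h0.ne'])
    rw [quadForm_smul, inv_pow, Real.sq_sqrt hs0, inv_mul_le_iff₀ h0] at h
    linarith

lemma quadForm_single_add_single {i j : Fin m} (a b : ℝ) :
    quadForm A (Pi.single i a + Pi.single j b) =
      a ^ 2 * A i i + a * b * (A i j + A j i) + b ^ 2 * A j j := by
  simp only [quadForm, Pi.add_apply, Pi.single_apply, add_mul, mul_add, Finset.sum_add_distrib,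
    ite_mul, mul_ite, zero_mul, mul_zero, Finset.sum_ite_eq', Finset.mem_univ, if_true]
  ring

lemma diag_le_maxEigOn {i : Fin m} (hi : p i) : A i i ≤ maxEigOn A p := by
  have h := quadForm_le_maxEigOn (A := A) (p := p) (x := Pi.single i 1 + Pi.single i 0)
    (fun k hk => by
      have : k ≠ i := fun h => hk (h ▸ hi)
      simp [this]) (by simp [Pi.single_apply])
  rw [quadForm_single_add_single] at h
  linarith

/-- If a diagonal entry of a symmetric matrix attains the largest eigenvalue, then the
off-diagonal entries of its row vanish. -/
lemma offDiag_eq_zero_of_diag_eq_maxEigOn {i j : Fin m} (hA : A i j = A j i) (hi : p i)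
    (hj : p j) (hij : i ≠ j) (hmax : A i i = maxEigOn A p) : A i j = 0 := by
  have key : ∀ a : ℝ, 2 * a * A i j ≤ maxEigOn A p - A j j := fun a => by
    have h := quadForm_le_maxEigOn_mul (A := A) (p := p) (x := Pi.single i a + Pi.single j 1)
      (fun k hk => by
        have h1 : k ≠ i := fun h => hk (h ▸ hi)
        have h2 : k ≠ j := fun h => hk (h ▸ hj)
        simp [h1, h2])
    have hn : ∑ k, (Pi.single i a + Pi.single j 1 : Fin m → ℝ) k ^ 2 = a ^ 2 + 1 := by
      have h1 : ∀ k, (Pi.single i a + Pi.single j 1 : Fin m → ℝ) k ^ 2 =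
          (if k = i then a ^ 2 else 0) + (if k = j then 1 else 0) := fun k => by
        simp only [Pi.add_apply, Pi.single_apply]
        by_cases h1 : k = i
        · simp [h1, hij]
        · by_cases h2 : k = j <;> simp [h1, h2, hij.symm]
      simp only [h1, Finset.sum_add_distrib, Finset.sum_ite_eq', Finset.mem_univ, if_true]
    rw [quadForm_single_add_single, hn, ← hA, hmax] at h
    linarith
  by_contra h
  have h1 := key ((maxEigOn A p - A j j + 1) / (2 * A i j))
  have h2 : 2 * ((maxEigOn A p - A j j + 1) / (2 * A i j)) * A i j =
      maxEigOn A p - A j j + 1 := by field_simp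
  linarith

end MaxEig

section Rectangular

variable {m n : ℕ} (hmn : m ≤ n)

lemma sum_castLE {f : Fin n → ℝ} (hf : ∀ j ∉ Set.range (Fin.castLE hmn), f j = 0) :
    ∑ j, f j = ∑ i, f (Fin.castLE hmn i) :=
  (Fintype.sum_of_injective _ (Fin.castLE_injective hmn) _ f hf fun _ => rfl).symm

lemma sum_mul_diagRect (f : Fin m → Fin n → ℝ) (s : Fin m → ℝ) :
    ∑ i, ∑ j, f i j * (diagRect s : Matrix (Fin m) (Fin n) ℝ) i j =
      ∑ i, s i * f i (Fin.castLE hmn i) := by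
  refine Finset.sum_congr rfl fun i _ => ?_
  rw [Finset.sum_eq_single (Fin.castLE hmn i)]
  · simp [diagRect, mul_comm]
  · intro j _ hj
    have : (j : ℕ) ≠ i := fun h => hj (Fin.ext h)
    simp [diagRect, this]
  · simp

lemma bilin_diagRect (s : Fin m → ℝ) (u : Fin m → ℝ) (y : Fin n → ℝ) :
    u ⬝ᵥ (diagRect s : Matrix (Fin m) (Fin n) ℝ) *ᵥ y =
      ∑ i, s i * (u i * y (Fin.castLE hmn i)) := by
  rw [← sum_mul_diagRect hmn (fun i j => u i * y j)]
  simp only [dotProduct, mulVec, Finset.mul_sum]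
  exact Finset.sum_congr rfl fun i _ => Finset.sum_congr rfl fun j _ => by ring

lemma symLeft_comm (A : Matrix (Fin m) (Fin n) ℝ) (i j : Fin m) :
    symLeft hmn A i j = symLeft hmn A j i := by
  simp [symLeft, add_comm]

lemma symLeft_diag (A : Matrix (Fin m) (Fin n) ℝ) (i : Fin m) :
    symLeft hmn A i i = A i (Fin.castLE hmn i) := by
  simp [symLeft]

lemma bilin_eq_quadForm_symLeft (A : Matrix (Fin m) (Fin n) ℝ) {u : Fin m → ℝ} {y : Fin n → ℝ}
    (huy : ∀ i, y (Fin.castLE hmn i) = u i)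
    (hy : ∀ j ∉ Set.range (Fin.castLE hmn), y j = 0) :
    u ⬝ᵥ A *ᵥ y = quadForm (symLeft hmn A) u := by
  have h1 : u ⬝ᵥ A *ᵥ y = ∑ i, ∑ j, u i * A i (Fin.castLE hmn j) * u j := by
    simp only [dotProduct, mulVec]
    refine Finset.sum_congr rfl fun i _ => ?_
    rw [sum_castLE hmn fun j hj => by simp [hy j hj], Finset.mul_sum]
    exact Finset.sum_congr rfl fun j _ => by rw [huy]; ring
  have h2 : u ⬝ᵥ A *ᵥ y = ∑ i, ∑ j, u i * A j (Fin.castLE hmn i) * u j := by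
    rw [h1, Finset.sum_comm]
    exact Finset.sum_congr rfl fun i _ => Finset.sum_congr rfl fun j _ => by ring
  have h3 : quadForm (symLeft hmn A) u =
      ((∑ i, ∑ j, u i * A i (Fin.castLE hmn j) * u j) +
        ∑ i, ∑ j, u i * A j (Fin.castLE hmn i) * u j) / 2 := by
    simp only [quadForm, symLeft, Matrix.of_apply, ← Finset.sum_add_distrib, Finset.sum_div]
    exact Finset.sum_congr rfl fun i _ => Finset.sum_congr rfl fun j _ => by ring
  rw [h3, ← h1, ← h2]; ring

/-- Unit vectors attaining the spectral norm `c` of `[Diag s 0]` agree and are supported on the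
indices with `s i = c`. -/
lemma eq_of_bilin_diagRect_eq {s : Fin m → ℝ} {c : ℝ} (hc : 0 < c) (hs0 : ∀ i, 0 ≤ s i)
    (hsc : ∀ i, s i ≤ c) {u : Fin m → ℝ} {y : Fin n → ℝ} (hu : ∑ i, u i ^ 2 = 1)
    (hy : ∑ j, y j ^ 2 = 1) (h : u ⬝ᵥ (diagRect s : Matrix (Fin m) (Fin n) ℝ) *ᵥ y = c) :
    (∀ i, s i < c → u i = 0) ∧ (∀ i, y (Fin.castLE hmn i) = u i) ∧
      ∀ j ∉ Set.range (Fin.castLE hmn), y j = 0 := by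
  rw [bilin_diagRect hmn] at h
  have hsub : ∀ T : Finset (Fin n), ∑ j ∈ T, y j ^ 2 ≤ 1 := fun T =>
    hy ▸ Finset.sum_le_sum_of_subset_of_nonneg (Finset.subset_univ T) fun j _ _ => sq_nonneg _
  have hle : ∑ i, y (Fin.castLE hmn i) ^ 2 ≤ 1 := by
    have := hsub (Finset.univ.map (Fin.castLEEmb hmn))
    simpa using this
  have hdecomp : ∀ i, c * u i ^ 2 + c * y (Fin.castLE hmn i) ^ 2 -
      2 * (s i * (u i * y (Fin.castLE hmn i))) =
      s i * (u i - y (Fin.castLE hmn i)) ^ 2 +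
        (c - s i) * (u i ^ 2 + y (Fin.castLE hmn i) ^ 2) := fun i => by ring
  have hnn1 : ∀ i, 0 ≤ s i * (u i - y (Fin.castLE hmn i)) ^ 2 := fun i =>
    mul_nonneg (hs0 i) (sq_nonneg _)
  have hnn2 : ∀ i, 0 ≤ (c - s i) * (u i ^ 2 + y (Fin.castLE hmn i) ^ 2) := fun i =>
    mul_nonneg (sub_nonneg.mpr (hsc i)) (by positivity)
  have hsum : ∑ i, (c * u i ^ 2 + c * y (Fin.castLE hmn i) ^ 2 -
      2 * (s i * (u i * y (Fin.castLE hmn i)))) ≤ 0 := by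
    rw [Finset.sum_sub_distrib, Finset.sum_add_distrib, ← Finset.mul_sum, ← Finset.mul_sum,
      ← Finset.mul_sum, hu, h]
    nlinarith
  have hzero : ∀ i, s i * (u i - y (Fin.castLE hmn i)) ^ 2 +
      (c - s i) * (u i ^ 2 + y (Fin.castLE hmn i) ^ 2) = 0 := fun i => by
    rw [← hdecomp]
    have hnn : ∀ i ∈ Finset.univ, 0 ≤ c * u i ^ 2 + c * y (Fin.castLE hmn i) ^ 2 -
        2 * (s i * (u i * y (Fin.castLE hmn i))) := fun i _ => by
      rw [hdecomp]; exact add_nonneg (hnn1 i) (hnn2 i)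
    exact (Finset.sum_eq_zero_iff_of_nonneg hnn).mp
      (le_antisymm hsum (Finset.sum_nonneg hnn)) i (Finset.mem_univ i)
  have hlt : ∀ i, s i < c → u i = 0 ∧ y (Fin.castLE hmn i) = 0 := fun i hi => by
    have h1 : (c - s i) * (u i ^ 2 + y (Fin.castLE hmn i) ^ 2) = 0 := by
      linarith [hzero i, hnn1 i, hnn2 i]
    have h2 := (mul_eq_zero.mp h1).resolve_left (sub_pos.mpr hi).ne'
    constructor <;> nlinarith [sq_nonneg (u i), sq_nonneg (y (Fin.castLE hmn i))]
  have heq : ∀ i, y (Fin.castLE hmn i) = u i := fun i => by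
    rcases (hsc i).lt_or_eq with hi | hi
    · rw [(hlt i hi).1, (hlt i hi).2]
    · have h1 : s i * (u i - y (Fin.castLE hmn i)) ^ 2 = 0 := by
        linarith [hzero i, hnn1 i, hnn2 i]
      have h2 := (mul_eq_zero.mp h1).resolve_left (hi ▸ hc).ne'
      linarith [pow_eq_zero_iff two_ne_zero |>.mp h2]
  refine ⟨fun i hi => (hlt i hi).1, heq, fun j hj => ?_⟩
  have hj' : j ∉ Finset.univ.map (Fin.castLEEmb hmn) := by
    intro h
    obtain ⟨i, -, hi⟩ := Finset.mem_map.mp h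
    exact hj ⟨i, hi⟩
  have h1 := hsub (insert j (Finset.univ.map (Fin.castLEEmb hmn)))
  rw [Finset.sum_insert hj', Finset.sum_map] at h1
  simp only [Fin.coe_castLEEmb, heq, hu] at h1
  nlinarith [sq_nonneg (y j)]

/-- Extension by zero of a vector along `Fin.castLE`. -/
lemma exists_zero_extension (u : Fin m → ℝ) : ∃ y : Fin n → ℝ,
    (∀ i, y (Fin.castLE hmn i) = u i) ∧ (∀ j ∉ Set.range (Fin.castLE hmn), y j = 0) ∧
      ∑ j, y j ^ 2 = ∑ i, u i ^ 2 := by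
  have hinj := Fin.castLE_injective hmn
  have h1 : ∀ i, Function.extend (Fin.castLE hmn) u 0 (Fin.castLE hmn i) = u i :=
    fun i => hinj.extend_apply _ _ _
  have h2 : ∀ j ∉ Set.range (Fin.castLE hmn), Function.extend (Fin.castLE hmn) u 0 j = 0 :=
    fun j hj => Function.extend_apply' _ _ _ hj
  refine ⟨Function.extend (Fin.castLE hmn) u 0, h1, h2, ?_⟩
  rw [sum_castLE hmn fun j hj => by rw [h2 j hj]; simp]
  simp only [h1]

lemma minner_eq_sum_of_svd {D W : Matrix (Fin m) (Fin n) ℝ} {U : Matrix (Fin m) (Fin m) ℝ}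
    {V : Matrix (Fin n) (Fin n) ℝ} {w : Fin m → ℝ}
    (hW : W = U * (diagRect w : Matrix (Fin m) (Fin n) ℝ) * Vᵀ) :
    minner D W = ∑ i, w i * symLeft hmn (Uᵀ * D * V) i i := by
  have h : minner D W = ((Uᵀ * D * V)ᵀ * (diagRect w : Matrix (Fin m) (Fin n) ℝ)).trace := by
    rw [minner, hW, ← Matrix.mul_assoc, Matrix.trace_mul_comm]
    simp only [Matrix.transpose_mul, Matrix.transpose_transpose, Matrix.mul_assoc]
  rw [h]
  simp only [symLeft_diag]
  rw [← sum_mul_diagRect hmn (fun i j => (Uᵀ * D * V) i j), Finset.sum_comm]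
  rfl

lemma bilin_orthogonal (A : Matrix (Fin m) (Fin n) ℝ) (U : Matrix (Fin m) (Fin m) ℝ)
    (V : Matrix (Fin n) (Fin n) ℝ) (u : Fin m → ℝ) (y : Fin n → ℝ) :
    (U *ᵥ u) ⬝ᵥ A *ᵥ (V *ᵥ y) = u ⬝ᵥ (Uᵀ * A * V) *ᵥ y := by
  rw [← mulVec_mulVec, ← mulVec_mulVec, dotProduct_mulVec u, ← mulVec_transpose,
    transpose_transpose]

/-- The directional derivative of the spectral norm at `P = U [Diag s 0] Vᵀ` is the largest
eigenvalue of the block of `S(Uᵀ D V)` belonging to the largest singular value. -/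
lemma dirDeriv_specNorm_eq_maxEigOn {P D : Matrix (Fin m) (Fin n) ℝ}
    {U : Matrix (Fin m) (Fin m) ℝ} {V : Matrix (Fin n) (Fin n) ℝ} {s : Fin m → ℝ}
    (hU : Uᵀ * U = 1) (hV : Vᵀ * V = 1)
    (hP : P = U * (diagRect s : Matrix (Fin m) (Fin n) ℝ) * Vᵀ)
    (hpos : 0 < specNorm P) (hs0 : ∀ i, 0 ≤ s i) (hsc : ∀ i, s i ≤ specNorm P)
    (hex : ∃ i, s i = specNorm P) {p : Fin m → Prop} (hp : ∀ i, p i ↔ s i = specNorm P) :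
    dirDeriv specNorm P D = maxEigOn (symLeft hmn (Uᵀ * D * V)) p := by
  have hU' : U * Uᵀ = 1 := mul_eq_one_comm.mp hU
  have hV' : V * Vᵀ = 1 := mul_eq_one_comm.mp hV
  have hP' : Uᵀ * P * V = diagRect s := by
    rw [hP, Matrix.mul_assoc U, ← Matrix.mul_assoc Uᵀ, hU, Matrix.one_mul, Matrix.mul_assoc, hV,
      Matrix.mul_one]
  refine dirDeriv_specNorm_eq hpos ?_ ?_
  · intro u y hu hy h
    have hu' : U *ᵥ (Uᵀ *ᵥ u) = u := by rw [mulVec_mulVec, hU', one_mulVec]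
    have hy' : V *ᵥ (Vᵀ *ᵥ y) = y := by rw [mulVec_mulVec, hV', one_mulVec]
    have hu1 : ∑ i, (Uᵀ *ᵥ u) i ^ 2 = 1 := by
      rw [sum_sq_mulVec_of_orthogonal (by rwa [transpose_transpose]), hu]
    have hy1 : ∑ j, (Vᵀ *ᵥ y) j ^ 2 = 1 := by
      rw [sum_sq_mulVec_of_orthogonal (by rwa [transpose_transpose]), hy]
    rw [← hu', ← hy', bilin_orthogonal, hP'] at h
    obtain ⟨h1, h2, h3⟩ := eq_of_bilin_diagRect_eq hmn hpos hs0 hsc hu1 hy1 h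
    rw [← hu', ← hy', bilin_orthogonal, bilin_eq_quadForm_symLeft hmn _ h2 h3]
    exact quadForm_le_maxEigOn
      (fun i hi => h1 i (lt_of_le_of_ne (hsc i) fun h => hi ((hp i).mpr h))) hu1
  · intro t ht
    suffices h : maxEigOn (symLeft hmn (Uᵀ * D * V)) p ≤
        (specNorm (P + t • D) - specNorm P) / t by
      rw [le_div_iff₀ ht] at h; linarith
    obtain ⟨i₀, hi₀⟩ := hex
    refine csSup_le ⟨_, Pi.single i₀ 1, fun i hi => ?_, by simp [Pi.single_apply], rfl⟩ ?_
    · have : i ≠ i₀ := fun h => hi ((hp i).mpr (h ▸ hi₀))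
      simp [this]
    rintro r ⟨x, hx, hx1, rfl⟩
    obtain ⟨y, h1, h2, h3⟩ := exists_zero_extension hmn x
    have h4 := bilin_le_specNorm (A := P + t • D) (u := U *ᵥ x) (y := V *ᵥ y)
      (by rw [sum_sq_mulVec_of_orthogonal hU, hx1])
      (by rw [sum_sq_mulVec_of_orthogonal hV, h3, hx1])
    have h5 : x ⬝ᵥ (diagRect s : Matrix (Fin m) (Fin n) ℝ) *ᵥ y = specNorm P := by
      rw [bilin_diagRect hmn, ← mul_one (specNorm P), ← hx1, Finset.mul_sum]
      refine Finset.sum_congr rfl fun i _ => ?_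
      by_cases hi : p i
      · rw [(hp i).mp hi, h1]; ring
      · simp [hx i hi]
    rw [add_mulVec, smul_mulVec, dotProduct_add, dotProduct_smul, smul_eq_mul, bilin_orthogonal,
      bilin_orthogonal, hP', h5, bilin_eq_quadForm_symLeft hmn _ h1 h2] at h4
    rw [le_div_iff₀ ht]; linarith

end Rectangular

/-- Remark 3.1: (a) the index sets α₁ and α₂ cannot both be nonempty,
and if α₁ ≠ ∅ then |α₁| = 1 and α₂ = ∅; (b) `D ∈ C_θ(P,W)` iff `S(D̃_{αα})` is the
block-diagonal matrix `Diag( λ₁(S(D̃_{αα}))·I_{|α₁|+|α₂|}, S(D̃_{α₃α₃}) )`. -/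
theorem critTheta_tau_is_maxEig {m n : ℕ} (hmn : m ≤ n)
    (P W : Matrix (Fin m) (Fin n) ℝ) (hP : P ≠ 0)
    (hW : W ∈ subdiff specNorm P)
    (U : Matrix (Fin m) (Fin m) ℝ) (V : Matrix (Fin n) (Fin n) ℝ) (σ : Fin m → ℝ)
    (hU : Uᵀ * U = 1) (hV : Vᵀ * V = 1)
    (hσa : Antitone σ) (hσ0 : ∀ i, 0 ≤ σ i)
    (hSVD : P + W = U * (diagRect σ : Matrix (Fin m) (Fin n) ℝ) * Vᵀ)
    (lam : ℝ) (hlam0 : 0 < lam) (hlamP : lam = specNorm P)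
    (hlam1 : ∑ i, max (σ i - lam) 0 = 1)
    (hPdec : P = U * (diagRect (fun i => min (σ i) lam) : Matrix (Fin m) (Fin n) ℝ) * Vᵀ)
    (hWdec : W = U * (diagRect (fun i => max (σ i - lam) 0) : Matrix (Fin m) (Fin n) ℝ) * Vᵀ) :
    -- (a) α₁ and α₂ cannot both be nonempty; if α₁ ≠ ∅ then |α₁| = 1 and α₂ = ∅
    (¬ ((∃ i, σ i = lam + 1) ∧ (∃ i, lam < σ i ∧ σ i < lam + 1)) ∧
      ((∃ i, σ i = lam + 1) →
        (∃! i, σ i = lam + 1) ∧ ∀ i, ¬ (lam < σ i ∧ σ i < lam + 1))) ∧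
    -- (b) D ∈ C_θ(P,W) iff S(D̃_{αα}) = Diag( λ₁(S(D̃_{αα}))·I_{|α₁|+|α₂|}, S(D̃_{α₃α₃}) )
    (∀ D : Matrix (Fin m) (Fin n) ℝ,
      D ∈ critTheta P W ↔
        ∀ i j : Fin m, lam ≤ σ i → lam ≤ σ j →
          ((lam < σ i → lam < σ j →
            symLeft hmn (Uᵀ * D * V) i j =
              if i = j then maxEigOn (symLeft hmn (Uᵀ * D * V)) (fun k => lam ≤ σ k)
              else 0) ∧
          ((lam < σ i ∧ σ j = lam) ∨ (σ i = lam ∧ lam < σ j) →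
            symLeft hmn (Uᵀ * D * V) i j = 0))) := by
  have hw0 : ∀ i, 0 ≤ max (σ i - lam) 0 := fun i => le_max_right _ _
  have huniq : ∀ i j, σ i = lam + 1 → lam < σ j → j = i := by
    intro i j hi hj
    by_contra hne
    have h : ∑ k ∈ {i, j}, max (σ k - lam) 0 ≤ ∑ k, max (σ k - lam) 0 :=
      Finset.sum_le_sum_of_subset_of_nonneg (Finset.subset_univ _) fun k _ _ => hw0 k
    rw [Finset.sum_pair (Ne.symm hne), hlam1] at h
    linarith [le_max_left (σ i - lam) 0, le_max_left (σ j - lam) 0]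
  have ha : ∀ i, σ i = lam + 1 → ∀ j, ¬ (lam < σ j ∧ σ j < lam + 1) := by
    rintro i hi j ⟨hj, hj'⟩
    rw [huniq i j hi hj, hi] at hj'
    exact lt_irrefl _ hj'
  refine ⟨⟨fun ⟨⟨i, hi⟩, ⟨j, hj⟩⟩ => ha i hi j hj, fun ⟨i, hi⟩ =>
    ⟨⟨i, hi, fun j hj => huniq i j hi (by rw [hj]; linarith)⟩, ha i hi⟩⟩, fun D => ?_⟩
  obtain ⟨i₀, hi₀⟩ : ∃ i, lam < σ i := by
    by_contra! h
    rw [Finset.sum_eq_zero fun i _ => max_eq_right (by linarith [h i])] at hlam1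
    exact zero_ne_one hlam1
  set S := symLeft hmn (Uᵀ * D * V) with hS
  set μ := maxEigOn S (fun k => lam ≤ σ k) with hμ
  have hdir : dirDeriv specNorm P D = μ :=
    dirDeriv_specNorm_eq_maxEigOn hmn hU hV hPdec (hlamP ▸ hlam0)
      (fun i => le_min (hσ0 i) hlam0.le) (fun i => hlamP ▸ min_le_right _ _)
      ⟨i₀, hlamP ▸ min_eq_right hi₀.le⟩ (fun i => by rw [← hlamP, min_eq_right_iff])
  have hmem : D ∈ critTheta P W ↔ ∀ i, lam < σ i → S i i = μ := by
    have h1 : D ∈ critTheta P W ↔ ∑ i, max (σ i - lam) 0 * (μ - S i i) = 0 := by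
      change dirDeriv specNorm P D = minner D W ↔ _
      simp only [mul_sub, Finset.sum_sub_distrib]
      rw [hdir, minner_eq_sum_of_svd hmn hWdec, ← Finset.sum_mul, hlam1, one_mul, sub_eq_zero]
    have hnn : ∀ i ∈ Finset.univ, 0 ≤ max (σ i - lam) 0 * (μ - S i i) := by
      intro i _
      rcases le_or_gt lam (σ i) with hi | hi
      · exact mul_nonneg (hw0 i)
          (sub_nonneg.mpr (diag_le_maxEigOn (p := fun k => lam ≤ σ k) hi))
      · rw [max_eq_right (by linarith), zero_mul]
    rw [h1, Finset.sum_eq_zero_iff_of_nonneg hnn]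
    refine forall_congr' fun i => ?_
    rcases lt_or_ge lam (σ i) with hi | hi
    · have : max (σ i - lam) 0 ≠ 0 := (lt_max_of_lt_left (sub_pos.mpr hi)).ne'
      simp [hi, this, sub_eq_zero, eq_comm (a := μ)]
    · simp [hi, not_lt.mpr hi]
  have hoff : (∀ i, lam < σ i → S i i = μ) → ∀ i j, lam < σ i → lam ≤ σ j → i ≠ j →
      S i j = 0 := fun h i j hi hj hij =>
    offDiag_eq_zero_of_diag_eq_maxEigOn (p := fun k => lam ≤ σ k) (symLeft_comm hmn _ i j)
      hi.le hj hij (h i hi)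
  rw [hmem]
  constructor
  · refine fun h i j hi hj => ⟨fun hi' hj' => ?_, ?_⟩
    · split_ifs with hij
      · rw [← hij]; exact h i hi'
      · exact hoff h i j hi' hj hij
    · rintro (⟨hi', hj'⟩ | ⟨hi', hj'⟩)
      · exact hoff h i j hi' hj fun hij => by rw [hij, hj'] at hi'; exact lt_irrefl _ hi'
      · rw [hS, symLeft_comm]
        exact hoff h j i hj' hi fun hij => by rw [hij, hi'] at hj'; exact lt_irrefl _ hj'
  · intro h i hi
    simpa using (h i i hi.le hi.le).1 hi hi

end
end
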